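/- Let G = PSL(2, F_17) be the projective special linear group of degree 2 over the field with 17 elements. Then a subgroup H of G fails to be pronormal in G if and only if either H has order 2, or H has order 4 and H is not cyclic (i.e., H is isomorphic to the Klein four-group). In particular, every other subgroup of G is pronormal in G. -/

import Mathlib

/-- The conjugate `H^g := g⁻¹ H g` of a subgroup `H` by an element `g`. -/
def Subgroup.conjugate {G : Type*} [Group G] (H : Subgroup G) (g : G) : Subgroup G :=
  H.map (MulAut.conj g⁻¹).toMonoidHom

/-- A subgroup `H` of a group `G` is pronormal in `G` if for every `g ∈ G` there exists
`x ∈ ⟨H, H^g⟩` such that `H^x = H^g`. -/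
def IsPronormal {G : Type*} [Group G] (H : Subgroup G) : Prop :=
  ∀ g : G, ∃ x ∈ (H ⊔ H.conjugate g : Subgroup G), H.conjugate x = H.conjugate g


namespace P17

section general
variable {G : Type*} [Group G]

theorem mem_conj {H : Subgroup G} {g x : G} : x ∈ H.conjugate g ↔ g * x * g⁻¹ ∈ H := by
  unfold Subgroup.conjugate
  constructor
  · rintro ⟨y, hy, rfl⟩
    simpa [mul_assoc] using hy
  · intro h
    exact ⟨g * x * g⁻¹, h, by simp [mul_assoc]⟩

theorem conj_mul (H : Subgroup G) (g h : G) :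
    H.conjugate (g * h) = (H.conjugate g).conjugate h := by
  ext x
  simp only [mem_conj, mul_inv_rev, mul_assoc]

theorem conj_one (H : Subgroup G) : H.conjugate 1 = H := by
  ext x
  simp [mem_conj]

theorem conj_mono {H K : Subgroup G} (h : H ≤ K) (g : G) : H.conjugate g ≤ K.conjugate g :=
  fun x hx => mem_conj.2 (h (mem_conj.1 hx))

theorem conj_of_mem {H : Subgroup G} {g : G} (h : g ∈ H) : H.conjugate g = H := by
  ext x
  rw [mem_conj]
  constructor
  · intro hx
    have := H.mul_mem (H.mul_mem (H.inv_mem h) hx) h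
    simpa [mul_assoc] using this
  · intro hx
    exact H.mul_mem (H.mul_mem h hx) (H.inv_mem h)

theorem card_conj (H : Subgroup G) (g : G) : Nat.card (H.conjugate g) = Nat.card H := by
  unfold Subgroup.conjugate
  exact Nat.card_congr (H.equivMapOfInjective _ (MulAut.conj g⁻¹).injective).symm.toEquiv

theorem conj_eq [Finite G] {H : Subgroup G} {g : G} (h : ∀ x ∈ H, g * x * g⁻¹ ∈ H) :
    H.conjugate g = H := by
  symm
  apply Subgroup.eq_of_le_of_card_ge
  · intro x hx
    exact mem_conj.2 (h x hx)
  · rw [card_conj]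

theorem conj_cancel {H K : Subgroup G} {g : G} (h : H.conjugate g = K) :
    K.conjugate g⁻¹ = H := by
  rw [← h, ← conj_mul, mul_inv_cancel, conj_one]

theorem pronormal_comap {G' : Type*} [Group G'] (f : G →* G') (hf : Function.Surjective f)
    (H : Subgroup G') : IsPronormal (H.comap f) ↔ IsPronormal H := by
  have hc : ∀ g, (H.comap f).conjugate g = (H.conjugate (f g)).comap f := by
    intro g
    ext x
    simp [mem_conj, Subgroup.mem_comap]
  have hs : ∀ g, H.comap f ⊔ (H.comap f).conjugate g = (H ⊔ H.conjugate (f g)).comap f := by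
    intro g
    rw [hc, Subgroup.comap_sup_eq f _ _ hf]
  unfold IsPronormal
  constructor
  · intro h g'
    obtain ⟨g, rfl⟩ := hf g'
    obtain ⟨x, hx, hx2⟩ := h g
    rw [hs] at hx
    refine ⟨f x, hx, ?_⟩
    rw [hc, hc] at hx2
    exact Subgroup.comap_injective hf hx2
  · intro h g
    obtain ⟨x', hx, hx2⟩ := h (f g)
    obtain ⟨x, rfl⟩ := hf x'
    refine ⟨x, ?_, ?_⟩
    · rw [hs]
      exact hx
    · rw [hc, hc, hx2]

theorem pronormal_conj (H : Subgroup G) (y : G) : IsPronormal (H.conjugate y) ↔ IsPronormal H := by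
  rw [← pronormal_comap (MulAut.conj y).toMonoidHom (MulAut.conj y).surjective H]
  have : H.conjugate y = H.comap (MulAut.conj y).toMonoidHom := by
    ext x
    simp [mem_conj, Subgroup.mem_comap]
  rw [this]

theorem exists_conj_sylow [Finite G] {p : ℕ} [Fact p.Prime] (S : Sylow p G) (R : Subgroup G)
    (hR : IsPGroup p R) : ∃ y : G, R.conjugate y ≤ S := by
  obtain ⟨Q, hQ⟩ := hR.exists_le_sylow
  obtain ⟨y, hy⟩ := MulAction.exists_smul_eq G Q S
  refine ⟨y⁻¹, fun x hx => ?_⟩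
  rw [mem_conj] at hx
  rw [← hy, Sylow.coe_subgroup_smul]
  have := Subgroup.smul_mem_pointwise_smul _ (MulAut.conj y) _ (hQ hx)
  simpa [mul_assoc] using this

theorem weak_closed [Finite G] {p : ℕ} [Fact p.Prime] (S : Sylow p G) (K : Subgroup G)
    (hKS : K ≤ S) (hw : ∀ y, K.conjugate y ≤ S → K.conjugate y = K) (J : Subgroup G) (g : G)
    (h1 : K ≤ J) (h2 : K.conjugate g ≤ J) : ∃ x ∈ J, K.conjugate (g * x) = K := by
  have hKp : IsPGroup p K := S.isPGroup'.to_le hKS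
  have hKg : IsPGroup p (K.conjugate g) := hKp.map _
  have hK1 : IsPGroup p (K.subgroupOf J) :=
    hKp.comap_of_injective _ J.subtype_injective
  have hK2 : IsPGroup p ((K.conjugate g).subgroupOf J) :=
    hKg.comap_of_injective _ J.subtype_injective
  obtain ⟨P, hP⟩ := hK1.exists_le_sylow
  obtain ⟨P', hP'⟩ := hK2.exists_le_sylow
  obtain ⟨x, hx⟩ := MulAction.exists_smul_eq J P' P
  have hPp : IsPGroup p ((P : Subgroup J).map J.subtype) := P.isPGroup'.map _
  obtain ⟨y, hy⟩ := exists_conj_sylow S _ hPp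
  have e1 : K ≤ (P : Subgroup J).map J.subtype := by
    intro z hz
    exact ⟨⟨z, h1 hz⟩, hP (Subgroup.mem_subgroupOf.2 hz), rfl⟩
  have e2 : K.conjugate (g * (x : G)⁻¹) ≤ (P : Subgroup J).map J.subtype := by
    intro z hz
    rw [conj_mul, mem_conj, inv_inv] at hz
    have hm : (x : G)⁻¹ * z * x ∈ J := h2 hz
    have h3 : (⟨(x : G)⁻¹ * z * x, hm⟩ : J) ∈ P' := hP' (Subgroup.mem_subgroupOf.2 hz)
    have := Subgroup.smul_mem_pointwise_smul _ (MulAut.conj x) _ h3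
    have h4 : (MulAut.conj x • (⟨(x : G)⁻¹ * z * x, hm⟩ : J)) ∈ (x • P' : Sylow p J) := this
    rw [hx] at h4
    refine ⟨_, h4, ?_⟩
    simp [mul_assoc]
  have f1 := hw y ((conj_mono e1 y).trans hy)
  have f2 := hw (g * (x : G)⁻¹ * y) (by rw [conj_mul]; exact (conj_mono e2 y).trans hy)
  refine ⟨(x : G)⁻¹, J.inv_mem x.2, ?_⟩
  rw [conj_mul] at f2
  have := conj_cancel f2
  rw [conj_cancel f1] at this
  exact this.symm

theorem pronormal_reduce {H K : Subgroup G} (hKH : K ≤ H)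
    (hK : ∀ (J : Subgroup G) (g : G), K ≤ J → K.conjugate g ≤ J → ∃ x ∈ J, K.conjugate (g * x) = K)
    (h : ∀ g, K.conjugate g = K → ∃ x ∈ H ⊔ H.conjugate g, H.conjugate x = H.conjugate g) :
    IsPronormal H := by
  intro g
  obtain ⟨x, hx, hx2⟩ := hK (H ⊔ H.conjugate g) g (hKH.trans le_sup_left)
    ((conj_mono hKH g).trans le_sup_right)
  obtain ⟨y, hy, hy2⟩ := h _ hx2
  have hle : H ⊔ H.conjugate (g * x) ≤ H ⊔ H.conjugate g := by
    refine sup_le le_sup_left ?_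
    rw [conj_mul]
    exact (conj_mono le_sup_right x).trans (conj_of_mem hx).le
  refine ⟨y * x⁻¹, Subgroup.mul_mem _ (hle hy) (Subgroup.inv_mem _ hx), ?_⟩
  rw [conj_mul, hy2, ← conj_mul, mul_inv_cancel_right]

theorem not_pronormal [Finite G] {H : Subgroup G} (g : G) (hne : H.conjugate g ≠ H)
    (hn : ∀ h ∈ H, ∀ z ∈ H, (g⁻¹ * h * g) * z * (g⁻¹ * h * g)⁻¹ ∈ H) : ¬ IsPronormal H := by
  intro hp
  obtain ⟨x, hx, hx2⟩ := hp g
  have hle : H ⊔ H.conjugate g ≤ Subgroup.normalizer H := by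
    refine sup_le Subgroup.le_normalizer ?_
    intro w hw
    rw [mem_conj] at hw
    have hwc : H.conjugate w = H := by
      apply conj_eq
      intro z hz
      have := hn _ hw z hz
      simpa [mul_assoc] using this
    rw [Subgroup.mem_normalizer_iff]
    intro z
    rw [← mem_conj, hwc]
  have := Subgroup.mem_normalizer_iff.1 (hle hx)
  apply hne
  rw [← hx2]
  ext z
  rw [mem_conj, ← this]

theorem pronormal_top : IsPronormal (⊤ : Subgroup G) := by
  intro g
  exact ⟨g, by simp, rfl⟩

end general

end P17

namespace P17

/-- The special linear group. -/
abbrev SL := Matrix.SpecialLinearGroup (Fin 2) (ZMod 17)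

instance fact17 : Fact (Nat.Prime 17) := ⟨by norm_num⟩

theorem e00 (g h : SL) : (g * h) 0 0 = g 0 0 * h 0 0 + g 0 1 * h 1 0 := by
  simp [Matrix.SpecialLinearGroup.coe_mul, Matrix.mul_apply, Fin.sum_univ_two]
theorem e01 (g h : SL) : (g * h) 0 1 = g 0 0 * h 0 1 + g 0 1 * h 1 1 := by
  simp [Matrix.SpecialLinearGroup.coe_mul, Matrix.mul_apply, Fin.sum_univ_two]
theorem e10 (g h : SL) : (g * h) 1 0 = g 1 0 * h 0 0 + g 1 1 * h 1 0 := by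
  simp [Matrix.SpecialLinearGroup.coe_mul, Matrix.mul_apply, Fin.sum_univ_two]
theorem e11 (g h : SL) : (g * h) 1 1 = g 1 0 * h 0 1 + g 1 1 * h 1 1 := by
  simp [Matrix.SpecialLinearGroup.coe_mul, Matrix.mul_apply, Fin.sum_univ_two]
theorem i00 (g : SL) : (g⁻¹) 0 0 = g 1 1 := by
  simp [Matrix.SpecialLinearGroup.coe_inv, Matrix.adjugate_fin_two]
theorem i01 (g : SL) : (g⁻¹) 0 1 = - g 0 1 := by
  simp [Matrix.SpecialLinearGroup.coe_inv, Matrix.adjugate_fin_two]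
theorem i10 (g : SL) : (g⁻¹) 1 0 = - g 1 0 := by
  simp [Matrix.SpecialLinearGroup.coe_inv, Matrix.adjugate_fin_two]
theorem i11 (g : SL) : (g⁻¹) 1 1 = g 0 0 := by
  simp [Matrix.SpecialLinearGroup.coe_inv, Matrix.adjugate_fin_two]
theorem n_ (g : SL) (i j : Fin 2) : (-g) i j = - g i j := by
  simp
theorem o00 : (1 : SL) 0 0 = 1 := by simp
theorem o01 : (1 : SL) 0 1 = 0 := by simp
theorem o10 : (1 : SL) 1 0 = 0 := by simp
theorem o11 : (1 : SL) 1 1 = 1 := by simp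
theorem dt (g : SL) : g 0 0 * g 1 1 - g 0 1 * g 1 0 = 1 := by
  rw [← Matrix.det_fin_two]
  exact g.2
theorem sext {g h : SL} (h0 : g 0 0 = h 0 0) (h1 : g 0 1 = h 0 1) (h2 : g 1 0 = h 1 0)
    (h3 : g 1 1 = h 1 1) : g = h := by
  ext i j
  fin_cases i <;> fin_cases j <;> assumption

/-- Build an element from entries. -/
def mk (a b c d : ZMod 17) (h : a * d - b * c = 1) : SL :=
  ⟨!![a, b; c, d], by rw [Matrix.det_fin_two_of]; exact h⟩
theorem mk00 (a b c d : ZMod 17) (h) : mk a b c d h 0 0 = a := rfl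
theorem mk01 (a b c d : ZMod 17) (h) : mk a b c d h 0 1 = b := rfl
theorem mk10 (a b c d : ZMod 17) (h) : mk a b c d h 1 0 = c := rfl
theorem mk11 (a b c d : ZMod 17) (h) : mk a b c d h 1 1 = d := rfl

theorem card_SL : Nat.card SL = 4896 := by
  have h1 : Nat.card (Matrix.GeneralLinearGroup (Fin 2) (ZMod 17)) = 78336 := by
    have := Matrix.card_GL_field (𝔽 := ZMod 17) 2
    rw [this]
    simp [Fin.prod_univ_two, ZMod.card]
  let f : Matrix.GeneralLinearGroup (Fin 2) (ZMod 17) →* (ZMod 17)ˣ := Matrix.GeneralLinearGroup.det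
  have hf : Function.Surjective f := by
    intro u
    refine ⟨Matrix.GeneralLinearGroup.mkOfDetNeZero !![(u : ZMod 17), 0; 0, 1] (by simp), ?_⟩
    ext
    simp [f, Matrix.GeneralLinearGroup.mkOfDetNeZero]
  have h2 : Nat.card f.ker * Nat.card (ZMod 17)ˣ = 78336 := by
    rw [← h1, ← Subgroup.card_mul_index f.ker, Subgroup.index_ker, MonoidHom.range_eq_top.2 hf]
    simp
  have h3 : Nat.card (ZMod 17)ˣ = 16 := by
    rw [Nat.card_eq_fintype_card, ZMod.card_units]
  have h4 : Nat.card f.ker = Nat.card SL := by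
    refine Nat.card_congr (Equiv.ofBijective
      (fun x => (⟨(x.1 : Matrix (Fin 2) (Fin 2) (ZMod 17)), ?_⟩ : SL)) ⟨?_, ?_⟩)
    · have := x.2
      rw [MonoidHom.mem_ker] at this
      have := congrArg Units.val this
      simpa [f] using this
    · intro x y hxy
      have := congrArg Subtype.val hxy
      exact Subtype.ext (Units.ext this)
    · intro y
      refine ⟨⟨Matrix.SpecialLinearGroup.toGL y, ?_⟩, ?_⟩
      · rw [MonoidHom.mem_ker]
        ext
        simp [f]
      · ext i j
        simp
  rw [h3, h4] at h2
  omega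

theorem sq_one (x : SL) (h : x * x = 1) : x = 1 ∨ x = -1 := by
  have a0 := congrArg (fun y : SL => y 0 0) h
  have a1 := congrArg (fun y : SL => y 0 1) h
  have a2 := congrArg (fun y : SL => y 1 0) h
  have a3 := congrArg (fun y : SL => y 1 1) h
  simp only [e00, e01, e10, e11, o00, o01, o10, o11] at a0 a1 a2 a3
  have hd := dt x
  have htr : x 0 0 + x 1 1 ≠ 0 := by
    intro ht
    have : (2 : ZMod 17) = 0 := by linear_combination (-1 : ZMod 17) * hd - a0 + x 0 0 * ht
    exact absurd this (by decide)
  have hb : x 0 1 = 0 := by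
    apply (mul_eq_zero.1 _).resolve_right htr
    linear_combination a1
  have hc : x 1 0 = 0 := by
    apply (mul_eq_zero.1 _).resolve_right htr
    linear_combination a2
  rw [hb, hc] at hd a0 a3
  have ha : (x 0 0 - 1) * (x 0 0 + 1) = 0 := by linear_combination a0
  rcases mul_eq_zero.1 ha with h1 | h1
  · left
    have h1' : x 0 0 = 1 := by linear_combination h1
    apply sext <;> simp only [o00, o01, o10, o11, hb, hc, h1']
    rw [h1'] at hd
    linear_combination hd
  · right
    have h1' : x 0 0 = -1 := by linear_combination h1
    apply sext <;> simp only [n_, o00, o01, o10, o11, hb, hc, h1', neg_zero]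
    rw [h1'] at hd
    linear_combination -hd

/-- Upper unipotent elements. -/
def up (t : ZMod 17) : SL := mk 1 t 0 1 (by ring)

theorem up_mul (s t : ZMod 17) : up s * up t = up (s + t) := by
  apply sext <;> simp only [e00, e01, e10, e11, up, mk00, mk01, mk10, mk11] <;> ring

theorem up_pow (t : ZMod 17) (n : ℕ) : up t ^ n = up (n * t) := by
  induction n with
  | zero => 
    rw [pow_zero]
    apply sext <;> simp [up, mk00, mk01, mk10, mk11]
  | succ n ih =>
    rw [pow_succ, ih, up_mul]
    congr 1
    push_cast
    ring

theorem up_all {J : Subgroup SL} {t : ZMod 17} (ht : t ≠ 0) (h : up t ∈ J) (s : ZMod 17) :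
    up s ∈ J := by
  have := J.pow_mem h (s / t).val
  rw [up_pow, ZMod.natCast_zmod_val, div_mul_cancel₀ _ ht] at this
  exact this

theorem top_of_up {J : Subgroup SL} (hU : ∀ s, up s ∈ J) {h : SL} (hh : h ∈ J) (hc : h 1 0 ≠ 0) :
    J = ⊤ := by
  have key : ∀ s, mk 1 0 s 1 (by ring) ∈ J := by
    have hw : mk 0 (-(h 1 0)⁻¹) (h 1 0) 0 (by field_simp; ring) ∈ J := by
      have := J.mul_mem (J.mul_mem (hU (- h 0 0 / h 1 0)) hh) (hU (- h 1 1 / h 1 0))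
      convert this using 1
      have := dt h
      apply sext <;> simp only [e00, e01, e10, e11, up, mk00, mk01, mk10, mk11] <;> field_simp <;>
        first | ring1 | linear_combination this | linear_combination -this
    intro s
    have := J.mul_mem (J.mul_mem hw (hU (- s / (h 1 0)^2))) (J.inv_mem hw)
    convert this using 1
    apply sext <;> simp only [e00, e01, e10, e11, i00, i01, i10, i11, up, mk00, mk01, mk10, mk11] <;>
      field_simp <;> ring
  have key2 : ∀ g : SL, g 1 0 ≠ 0 → g ∈ J := by
    intro g hg
    have := J.mul_mem (J.mul_mem (hU ((g 0 0 - 1) / g 1 0)) (key (g 1 0)))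
      (hU ((g 1 1 - 1) / g 1 0))
    convert this using 1
    have := dt g
    apply sext <;> simp only [e00, e01, e10, e11, up, mk00, mk01, mk10, mk11] <;> field_simp <;>
      first | ring1 | linear_combination this | linear_combination -this
  rw [eq_top_iff]
  intro g _
  by_cases hg : g 1 0 = 0
  · have h1 : mk 1 0 1 1 (by ring) * g ∈ J := by
      apply key2
      simp only [e10, mk10, mk11, hg]
      intro h0
      have := dt g
      rw [hg] at this
      have h2 : (1 : ZMod 17) = 0 := by linear_combination -this + g 1 1 * h0
      exact one_ne_zero h2
    exact (J.mul_mem_cancel_left (key 1)).1 h1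
  · exact key2 g hg

theorem unip_conj (g : SL) (ht : g 0 0 + g 1 1 = 2) (hne : ¬ (g 0 1 = 0 ∧ g 1 0 = 0)) :
    ∃ (y : SL) (t : ZMod 17), t ≠ 0 ∧ y⁻¹ * g * y = up t := by
  have hd := dt g
  by_cases hr : g 1 0 = 0
  · refine ⟨1, g 0 1, fun h => hne ⟨h, hr⟩, ?_⟩
    have h0 : (g 0 0 - 1) ^ 2 = 0 := by
      rw [hr] at hd
      linear_combination (g 0 0) * ht - hd
    have h1 : g 0 0 = 1 := by
      have := pow_eq_zero_iff (two_ne_zero) |>.1 h0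
      linear_combination this
    apply sext <;> simp [up, mk00, mk01, mk10, mk11, h1, hr]
    linear_combination ht - h1
  · refine ⟨mk (g 0 0 - 1) (-(g 1 0)⁻¹) (g 1 0) 0 (by field_simp; ring), -(g 1 0)⁻¹, ?_, ?_⟩
    · simpa using hr
    · have h1 : g 1 1 = 2 - g 0 0 := by linear_combination ht
      rw [h1] at hd
      have h2 : g 0 1 = - (g 0 0 - 1)^2 / g 1 0 := by
        field_simp
        linear_combination -hd
      rw [mul_assoc, inv_mul_eq_iff_eq_mul]
      apply sext <;> simp only [e00, e01, e10, e11, up, mk00, mk01, mk10, mk11, h1, h2] <;>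
        field_simp <;> ring

end P17

namespace P17

theorem neg_comm_mem {H : Subgroup SL} (h1 : (-1 : SL) ∈ H) {x : SL} (hx : x ∈ H) : -x ∈ H := by
  have := H.mul_mem h1 hx
  simpa using this

theorem neg_one_mem_conj {H : Subgroup SL} (h1 : (-1 : SL) ∈ H) (y : SL) :
    (-1 : SL) ∈ H.conjugate y := by
  rw [mem_conj]
  simpa using h1

theorem tr_conj (g y : SL) : (y * g * y⁻¹) 0 0 + (y * g * y⁻¹) 1 1 = g 0 0 + g 1 1 := by
  have := dt y
  simp only [e00, e01, e10, e11, i00, i01, i10, i11]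
  linear_combination (g 0 0 + g 1 1) * this

theorem trace_of_order (x : SL) (h : x ^ 17 = 1) : x 0 0 + x 1 1 = 2 := by
  have h1 : ((x : Matrix (Fin 2) (Fin 2) (ZMod 17)) - 1) ^ 17 = 0 := by
    rw [sub_pow_char_of_commute 17 (Commute.one_right _), one_pow,
      ← Matrix.SpecialLinearGroup.coe_pow, h]
    simp
  have h2 := congrArg Matrix.det h1
  rw [Matrix.det_pow, Matrix.det_zero] at h2
  have h3 := pow_eq_zero_iff (by norm_num) |>.1 h2
  rw [Matrix.det_fin_two] at h3
  simp at h3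
  have := dt x
  linear_combination -h3 + this

theorem case17 (H : Subgroup SL) (h17 : 17 ∣ Nat.card H) : IsPronormal H := by
  obtain ⟨x, hx⟩ := exists_prime_orderOf_dvd_card' 17 h17
  have hx17 : (x : SL) ^ 17 = 1 := by
    have := pow_orderOf_eq_one x
    rw [hx] at this
    exact_mod_cast congrArg Subtype.val this
  have hx1 : (x : SL) ≠ 1 := by
    intro h
    rw [← Subgroup.orderOf_coe, h] at hx
    simp at hx
  have htr := trace_of_order _ hx17
  have hnd : ¬ ((x : SL) 0 1 = 0 ∧ (x : SL) 1 0 = 0) := by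
    rintro ⟨hb, hc⟩
    have hd := dt x
    rw [hb, hc] at hd
    have h0 : ((x : SL) 0 0 - 1) ^ 2 = 0 := by
      linear_combination ((x : SL) 0 0) * htr - hd
    have h1 : (x : SL) 0 0 = 1 := by
      have := pow_eq_zero_iff (two_ne_zero) |>.1 h0
      linear_combination this
    apply hx1
    apply sext
    · rw [h1, o00]
    · rw [hb, o01]
    · rw [hc, o10]
    · rw [o11]; linear_combination htr - h1
  obtain ⟨y, t, ht, hy⟩ := unip_conj x htr hnd
  rw [← pronormal_conj H y]
  have hU : ∀ s, up s ∈ H.conjugate y := by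
    apply up_all ht
    rw [← hy, mem_conj]
    simp [mul_assoc]
  generalize H.conjugate y = H at hU
  by_cases hB : ∃ h ∈ H, h 1 0 ≠ 0
  · obtain ⟨h, hh, hc⟩ := hB
    rw [top_of_up hU hh hc]
    exact pronormal_top
  · push Not at hB
    intro g
    by_cases hg : g 1 0 = 0
    · refine ⟨1, Subgroup.one_mem _, ?_⟩
      rw [conj_one]
      symm
      apply conj_eq
      intro h hh
      have hc := hB h hh
      have e : g * h * g⁻¹ = h * up ((g * h * g⁻¹ * h⁻¹) 0 1 * h 1 1 ^ 2) := by
        have d1 := dt g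
        have d2 := dt h
        rw [hc] at d2
        rw [hg] at d1
        apply sext <;> simp only [e00, e01, e10, e11, i00, i01, i10, i11, up, mk00, mk01, mk10,
          mk11, hc, hg]
        · linear_combination h 0 0 * d1
        · grind
        · ring
        · linear_combination h 1 1 * d1
      rw [e]
      exact H.mul_mem hh (hU _)
    · have : H ⊔ H.conjugate g = ⊤ := by
        have h1 : g⁻¹ * up 1 * g ∈ H ⊔ H.conjugate g := by
          apply (le_sup_right : H.conjugate g ≤ _)
          rw [mem_conj]
          simpa [mul_assoc] using hU 1
        refine top_of_up (fun s => (le_sup_left : H ≤ _) (hU s)) h1 ?_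
        simp only [e00, e01, e10, e11, i00, i01, i10, i11, up, mk00, mk01, mk10, mk11]
        ring_nf
        simpa using hg
      exact ⟨g, by rw [this]; trivial, rfl⟩

/-- Monomial matrices: a Sylow 2-subgroup. -/
def S2 : Subgroup SL where
  carrier := {g | (g 0 1 = 0 ∧ g 1 0 = 0) ∨ (g 0 0 = 0 ∧ g 1 1 = 0)}
  one_mem' := Or.inl ⟨o01, o10⟩
  mul_mem' := by
    intro g h hg hh
    simp only [Set.mem_ofPred_eq, e00, e01, e10, e11] at *
    rcases hg with ⟨a, b⟩ | ⟨a, b⟩ <;> rcases hh with ⟨c, d⟩ | ⟨c, d⟩ <;> simp [a, b, c, d]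
  inv_mem' := by
    intro g hg
    simp only [Set.mem_ofPred_eq, i00, i01, i10, i11] at *
    rcases hg with ⟨a, b⟩ | ⟨a, b⟩ <;> simp [a, b]

theorem mem_S2 {g : SL} : g ∈ S2 ↔ (g 0 1 = 0 ∧ g 1 0 = 0) ∨ (g 0 0 = 0 ∧ g 1 1 = 0) := Iff.rfl

theorem card_S2 : Nat.card S2 = 32 := by
  have e : Nat.card ((ZMod 17)ˣ × Bool) = 32 := by
    rw [Nat.card_prod, Nat.card_eq_fintype_card, ZMod.card_units]
    simp
  rw [← e]
  symm
  refine Nat.card_congr (Equiv.ofBijective (fun p => if p.2 then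
    ⟨mk p.1 0 0 (p.1⁻¹ : (ZMod 17)ˣ) (by rw [Units.mul_inv, mul_zero, sub_zero]), Or.inl ⟨rfl, rfl⟩⟩ else
    ⟨mk 0 p.1 (-(p.1⁻¹ : (ZMod 17)ˣ)) 0
      (by rw [mul_neg, Units.mul_inv, mul_zero, zero_sub, neg_neg]), Or.inr ⟨rfl, rfl⟩⟩) ⟨?_, ?_⟩)
  · rintro ⟨u, b⟩ ⟨v, c⟩ h
    have h0 := congrArg (fun z : S2 => z.1 0 0) h
    have h1 := congrArg (fun z : S2 => z.1 0 1) h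
    have hu := u.ne_zero
    have hv := v.ne_zero
    cases b <;> cases c
    · have h1' : (u : ZMod 17) = v := h1
      rw [Units.ext h1']
    · exact absurd h1 hu
    · exact absurd h0 hu
    · have h1' : (u : ZMod 17) = v := h0
      rw [Units.ext h1']
  · rintro ⟨g, hg⟩
    have hd := dt g
    rcases hg with ⟨a, b⟩ | ⟨a, b⟩
    · rw [a, b] at hd
      have hm : g 0 0 * g 1 1 = 1 := by linear_combination hd
      refine ⟨⟨Units.mkOfMulEqOne _ _ hm, true⟩, ?_⟩
      simp only [if_true]
      apply Subtype.ext
      apply sext <;> simp [mk00, mk01, mk10, mk11, a, b]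
      exact inv_eq_of_mul_eq_one_right hm
    · rw [a, b] at hd
      have hm : g 0 1 * (- g 1 0) = 1 := by linear_combination hd
      refine ⟨⟨Units.mkOfMulEqOne _ _ hm, false⟩, ?_⟩
      simp only [Bool.false_eq_true, if_false]
      apply Subtype.ext
      apply sext <;> simp [mk00, mk01, mk10, mk11, a, b]
      have := inv_eq_of_mul_eq_one_right hm
      rw [this]
      ring

instance fact2 : Fact (Nat.Prime 2) := ⟨by norm_num⟩
instance fact3 : Fact (Nat.Prime 3) := ⟨by norm_num⟩

theorem fz2 : (4896 : ℕ).factorization 2 = 5 := by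
  rw [show 4896 = 2 ^ 5 * 153 by norm_num, Nat.factorization_mul (by norm_num) (by norm_num),
    Finsupp.add_apply, Nat.Prime.factorization_pow (by norm_num),
    Nat.factorization_eq_zero_of_not_dvd (n := 153) (by norm_num)]
  simp

theorem fz3 : (4896 : ℕ).factorization 3 = 2 := by
  rw [show 4896 = 3 ^ 2 * 544 by norm_num, Nat.factorization_mul (by norm_num) (by norm_num),
    Finsupp.add_apply, Nat.Prime.factorization_pow (by norm_num),
    Nat.factorization_eq_zero_of_not_dvd (n := 544) (by norm_num)]
  simp

theorem syl2 : ∃ S : Sylow 2 SL, (S : Subgroup SL) = S2 :=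
  ⟨Sylow.ofCard S2 (by rw [card_S2, card_SL, fz2]; norm_num), rfl⟩

end P17

namespace P17

theorem seventeen : (17 : ZMod 17) = 0 := by decide

theorem dpow {h : SL} (hb : h 0 1 = 0) (hc : h 1 0 = 0) (n : ℕ) :
    (h ^ n) 0 1 = 0 ∧ (h ^ n) 1 0 = 0 ∧ (h ^ n) 0 0 = h 0 0 ^ n := by
  induction n with
  | zero => simp
  | succ n ih =>
    obtain ⟨i1, i2, i3⟩ := ih
    rw [pow_succ]
    simp only [e00, e01, e10, hb, hc, i1, i2, i3, mul_zero, zero_mul, add_zero]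
    refine ⟨trivial, trivial, ?_⟩
    rw [pow_succ]

theorem dext {g h : SL} (g1 : g 0 1 = 0) (g2 : g 1 0 = 0) (h1 : h 0 1 = 0) (h2 : h 1 0 = 0)
    (h0 : g 0 0 = h 0 0) : g = h := by
  have a := dt g
  have b := dt h
  rw [g1] at a
  rw [h1] at b
  apply sext h0 (g1.trans h1.symm) (g2.trans h2.symm)
  have hne : h 0 0 ≠ 0 := by
    intro h3
    rw [h3] at b
    simp at b
  apply mul_left_cancel₀ hne
  rw [h0] at a
  linear_combination a - b

theorem anti_sq {z : SL} (h0 : z 0 0 = 0) (h1 : z 1 1 = 0) : z ^ 2 = -1 := by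
  have := dt z
  rw [h0, h1] at this
  rw [pow_two]
  apply sext <;> simp only [e00, e01, e10, e11, n_, o00, o01, o10, o11, h0, h1]
  · linear_combination -this
  · ring
  · ring
  · linear_combination -this

theorem pow4_diag {h : SL} (hS : h ∈ S2) (h4 : h ^ 4 = -1) :
    h 0 1 = 0 ∧ h 1 0 = 0 ∧ h 0 0 ^ 4 = -1 := by
  rcases hS with ⟨b, c⟩ | ⟨a, d⟩
  · refine ⟨b, c, ?_⟩
    rw [← (dpow b c 4).2.2, h4]
    simp
  · exfalso
    have h5 : h ^ 4 = 1 := by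
      rw [show 4 = 2 * 2 from rfl, pow_mul, anti_sq a d]
      simp
    rw [h5] at h4
    have := congrArg (fun z : SL => z 0 0) h4
    simp only [n_, o00] at this
    exact absurd this (by decide)

/-- The diagonal subgroup of order eight. -/
def K4 : Subgroup SL where
  carrier := {g | g 0 1 = 0 ∧ g 1 0 = 0 ∧ g 0 0 ^ 8 = 1}
  one_mem' := ⟨o01, o10, by simp⟩
  mul_mem' := by
    rintro g h ⟨a, b, c⟩ ⟨d, e, f⟩
    refine ⟨?_, ?_, ?_⟩
    · simp [e01, a, d]
    · simp [e10, b, e]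
    · simp [e00, a, mul_pow, c, f]
  inv_mem' := by
    rintro g ⟨a, b, c⟩
    refine ⟨?_, ?_, ?_⟩
    · simp only [i01, a, neg_zero]
    · simp only [i10, b, neg_zero]
    · have := dt g
      rw [a] at this
      have h1 : g 0 0 * g 1 1 = 1 := by linear_combination this
      have h2 := congrArg (fun z => z ^ 8) h1
      simp only [mul_pow, c, one_mul, one_pow] at h2
      rw [i00]
      exact h2

theorem mem_K4 {g : SL} : g ∈ K4 ↔ g 0 1 = 0 ∧ g 1 0 = 0 ∧ g 0 0 ^ 8 = 1 := Iff.rfl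

theorem K4_le {H : Subgroup SL} (hS : H ≤ S2) {h : SL} (hh : h ∈ H) (h4 : h ^ 4 = -1) :
    K4 ≤ H := by
  intro x hx
  obtain ⟨b, c, t⟩ := pow4_diag (hS hh) h4
  rw [mem_K4] at hx
  have key : ∀ t s : ZMod 17, t ^ 4 = -1 → s ^ 8 = 1 → ∃ j : Fin 8, s = t ^ (j : ℕ) := by
    decide +kernel
  obtain ⟨j, hj⟩ := key _ _ t hx.2.2
  have := dpow b c j
  have e : x = h ^ (j : ℕ) := dext hx.1 hx.2.1 this.1 this.2.1 (by rw [this.2.2, hj])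
  rw [e]
  exact H.pow_mem hh _

/-- Element of order eight. -/
def r2 : SL := mk 9 0 0 2 (by decide)

theorem r2_mem : r2 ∈ K4 := ⟨rfl, rfl, by decide⟩
theorem r2_pow : r2 ^ 4 = -1 := by decide

theorem K4_le_S2 : K4 ≤ S2 := fun _ hx => Or.inl ⟨hx.1, hx.2.1⟩

theorem K4_weak (y : SL) (h : K4.conjugate y ≤ S2) : K4.conjugate y = K4 := by
  symm
  apply Subgroup.eq_of_le_of_card_ge
  · apply K4_le h (h := y⁻¹ * r2 * y)
    · rw [mem_conj]
      simpa [mul_assoc] using r2_mem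
    · have := conj_pow (i := 4) (a := y⁻¹) (b := r2)
      rw [inv_inv] at this
      rw [this, r2_pow]
      simp
  · rw [card_conj]

theorem K4_norm {g : SL} (h : K4.conjugate g = K4) : g ∈ S2 := by
  have h1 := r2_mem
  rw [← h, mem_conj, mem_K4] at h1
  obtain ⟨a, b, -⟩ := h1
  simp only [e00, e01, e10, e11, i00, i01, i10, i11, r2, mk00, mk01, mk10, mk11] at a b
  have h7 : (7 : ZMod 17) ≠ 0 := by decide
  have a' : g 0 0 * g 0 1 = 0 := by
    apply (mul_eq_zero.1 _).resolve_left h7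
    linear_combination -a
  have b' : g 1 0 * g 1 1 = 0 := by
    apply (mul_eq_zero.1 _).resolve_left h7
    linear_combination b
  have := dt g
  rw [mem_S2]
  rcases mul_eq_zero.1 a' with h1 | h1 <;> rcases mul_eq_zero.1 b' with h2 | h2 <;>
    simp [h1, h2] at this ⊢

theorem comm_entry {g h : SL} (hg : g ∈ S2) (hh : h ∈ S2) :
    (g * h * g⁻¹ * h⁻¹) 0 1 = 0 ∧ (g * h * g⁻¹ * h⁻¹) 1 0 = 0 ∧
    ((g 0 1 = 0 ∧ h 0 1 = 0 ∧ (g * h * g⁻¹ * h⁻¹) 0 0 = 1) ∨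
     (g 0 1 = 0 ∧ g 1 0 = 0 ∧ h 0 0 = 0 ∧ h 1 1 = 0 ∧ (g * h * g⁻¹ * h⁻¹) 0 0 = g 0 0 ^ 2) ∨
     (g 0 0 = 0 ∧ h 0 1 = 0 ∧ h 1 0 = 0 ∧ (g * h * g⁻¹ * h⁻¹) 0 0 = h 1 1 ^ 2) ∨
     (g 0 0 = 0 ∧ g 1 1 = 0 ∧ h 0 0 = 0 ∧ h 1 1 = 0 ∧
        (g * h * g⁻¹ * h⁻¹) 0 0 = (g 0 1 * h 1 0) ^ 2)) := by
  have d1 := dt g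
  have d2 := dt h
  simp only [e00, e01, e10, e11, i00, i01, i10, i11]
  rcases hg with ⟨a, b⟩ | ⟨a, b⟩ <;> rcases hh with ⟨c, d⟩ | ⟨c, d⟩ <;>
    simp only [a, b, c, d] at d1 d2 ⊢ <;> refine ⟨by ring, by ring, ?_⟩
  · left
    refine ⟨trivial, trivial, ?_⟩
    linear_combination g 0 0 * g 1 1 * d2 + d1
  · right; left
    refine ⟨trivial, trivial, trivial, trivial, ?_⟩
    linear_combination g 0 0 ^ 2 * d2
  · right; right; left
    refine ⟨trivial, trivial, trivial, ?_⟩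
    linear_combination h 1 1 ^ 2 * d1
  · right; right; right
    refine ⟨trivial, trivial, trivial, trivial, ?_⟩
    ring

theorem comm_K4 {g h : SL} (hg : g ∈ S2) (hh : h ∈ S2) : g * h * g⁻¹ * h⁻¹ ∈ K4 := by
  have key : ∀ x : ZMod 17, x = 0 ∨ (x ^ 2) ^ 8 = 1 := by decide
  have nz : (g * h * g⁻¹ * h⁻¹) 0 0 ≠ 0 := by
    obtain ⟨a, b, -⟩ := comm_entry hg hh
    have := dt (g * h * g⁻¹ * h⁻¹)
    intro h0
    rw [a, h0] at this
    simp at this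
  obtain ⟨a, b, c⟩ := comm_entry hg hh
  refine ⟨a, b, ?_⟩
  rcases c with ⟨-, -, c⟩ | ⟨-, -, -, -, c⟩ | ⟨-, -, -, c⟩ | ⟨-, -, -, -, c⟩
  · rw [c, one_pow]
  · rw [c] at nz ⊢
    rcases key (g 0 0) with e | e
    · rw [e] at nz
      simp at nz
    · exact e
  · rw [c] at nz ⊢
    rcases key (h 1 1) with e | e
    · rw [e] at nz
      simp at nz
    · exact e
  · rw [c] at nz ⊢
    rcases key (g 0 1 * h 1 0) with e | e
    · rw [e] at nz
      simp at nz
    · exact e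

theorem case2 (H : Subgroup SL) (hS : H ≤ S2) (h : SL) (hh : h ∈ H) (h4 : h ^ 4 = -1) :
    IsPronormal H := by
  have hK := K4_le hS hh h4
  obtain ⟨S, hSS⟩ := syl2
  apply pronormal_reduce hK
  · intro J g
    refine weak_closed S K4 ?_ ?_ J g
    · rw [hSS]; exact K4_le_S2
    · rw [hSS]; exact K4_weak
  · intro g hg
    have hgS := K4_norm hg
    refine ⟨1, Subgroup.one_mem _, ?_⟩
    rw [conj_one]
    symm
    apply conj_eq
    intro x hx
    have := H.mul_mem (hK (comm_K4 hgS (hS hx))) hx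
    simpa using this

theorem card_le_list {H : Subgroup SL} (l : List SL) (h : ∀ x ∈ H, x ∈ l) :
    Nat.card H ≤ l.length := by
  classical
  have h1 : (H : Set SL) ⊆ (l.toFinset : Set SL) := by
    intro x hx
    simpa using h x hx
  have h2 := Set.ncard_le_ncard h1 (Finset.finite_toSet _)
  rw [Set.ncard_coe_finset] at h2
  exact h2.trans (List.toFinset_card_le l)

/-- Diagonal element of order four. -/
def de : SL := mk 4 0 0 13 (by decide)

theorem diag4 {H : Subgroup SL} (hno : ∀ h ∈ H, h ^ 4 ≠ -1) {x : SL} (hx : x ∈ H)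
    (hb : x 0 1 = 0) (hc : x 1 0 = 0) : x = 1 ∨ x = -1 ∨ x = de ∨ x = -de := by
  have key : ∀ t : ZMod 17, t = 0 ∨ t ^ 4 = -1 ∨ t ^ 8 = -1 ∨ t = 1 ∨ t = -1 ∨ t = 4 ∨ t = -4 := by
    decide
  have hpow : ∀ n : ℕ, x 0 0 ^ n = -1 → x ^ n = -1 := by
    intro n hn
    obtain ⟨a, b, c⟩ := dpow hb hc n
    apply dext a b
    · simp
    · simp
    · rw [c, hn]; simp
  rcases key (x 0 0) with h | h | h | h | h | h | h
  · have := dt x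
    rw [h, hb] at this
    simp at this
  · exact absurd (hpow 4 h) (hno x hx)
  · refine absurd ?_ (hno (x ^ 2) (H.pow_mem hx 2))
    rw [← pow_mul]
    exact hpow 8 h
  · left; exact dext hb hc (by simp) (by simp) (by simpa using h)
  · right; left; exact dext hb hc (by simp) (by simp) (by simpa using h)
  · right; right; left; exact dext hb hc rfl rfl h
  · right; right; right
    exact dext hb hc (by simp [de, mk01]) (by simp [de, mk10]) (by simpa [de, mk00] using h)

theorem no8 {H : Subgroup SL} (hS : H ≤ S2) (h1 : (-1 : SL) ∈ H) (hno : ∀ h ∈ H, h ^ 4 ≠ -1)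
    (hc : 4 < Nat.card H) :
    de ∈ H ∧ (∃ z ∈ H, z 0 0 = 0 ∧ z 1 1 = 0) ∧ Nat.card H ≤ 8 := by
  have hz : ∃ z ∈ H, z 0 0 = 0 ∧ z 1 1 = 0 := by
    by_contra hcon
    push Not at hcon
    have := card_le_list (H := H) [1, -1, de, -de] (by
      intro x hx
      rcases hS hx with ⟨a, b⟩ | ⟨a, b⟩
      · simpa using diag4 hno hx a b
      · exact absurd b (hcon x hx a))
    simp at this
    omega
  obtain ⟨z, hz, z0, z1⟩ := hz
  have key : ∀ x ∈ H, x 0 0 = 0 → x 1 1 = 0 →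
      z⁻¹ * x = 1 ∨ z⁻¹ * x = -1 ∨ z⁻¹ * x = de ∨ z⁻¹ * x = -de := by
    intro x hx a b
    apply diag4 hno (H.mul_mem (H.inv_mem hz) hx)
    · simp only [e01, i00, i01, a, b, z0, z1]; ring
    · simp only [e10, i10, i11, a, b, z0, z1]; ring
  have hde : de ∈ H := by
    by_contra hde
    have hde' : -de ∉ H := fun h => hde (by simpa using neg_comm_mem h1 h)
    have := card_le_list (H := H) [1, -1, z, -z] (by
      intro x hx
      rcases hS hx with ⟨a, b⟩ | ⟨a, b⟩
      · rcases diag4 hno hx a b with h | h | h | h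
        · simp [h]
        · simp [h]
        · exact absurd (h ▸ hx) hde
        · exact absurd (h ▸ hx) hde'
      · have hm := H.mul_mem (H.inv_mem hz) hx
        rcases key x hx a b with h | h | h | h
        · rw [inv_mul_eq_iff_eq_mul] at h
          simp [h]
        · rw [inv_mul_eq_iff_eq_mul] at h
          simp [h]
        · exact absurd (h ▸ hm) hde
        · exact absurd (h ▸ hm) hde')
    simp at this
    omega
  refine ⟨hde, ⟨z, hz, z0, z1⟩, ?_⟩
  have := card_le_list (H := H) [1, -1, de, -de, z * 1, z * -1, z * de, z * -de] (by
      intro x hx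
      rcases hS hx with ⟨a, b⟩ | ⟨a, b⟩
      · rcases diag4 hno hx a b with h | h | h | h <;> simp [h]
      · rcases key x hx a b with h | h | h | h <;>
        · rw [inv_mul_eq_iff_eq_mul] at h
          simp [h])
  simpa using this

/-- Diagonal element of order sixteen. -/
def r1 : SL := mk 3 0 0 6 (by decide)

theorem caseV {H : Subgroup SL} (hS : H ≤ S2) (h1 : (-1 : SL) ∈ H) (hno : ∀ h ∈ H, h ^ 4 ≠ -1)
    (hc : 4 < Nat.card H) : ¬ IsPronormal H := by
  obtain ⟨hde, ⟨z, hz, z0, z1⟩, -⟩ := no8 hS h1 hno hc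
  have hent : ∀ x : SL, x 0 1 = 0 → x 1 0 = 0 →
      (x 0 0 = 1 ∨ x 0 0 = -1 ∨ x 0 0 = 4 ∨ x 0 0 = -4) → x ∈ H := by
    intro x hb hc' h
    rcases h with h | h | h | h
    · rw [show x = 1 from dext hb hc' (by simp) (by simp) (by simpa using h)]
      exact H.one_mem
    · rw [show x = -1 from dext hb hc' (by simp) (by simp) (by simpa using h)]
      exact h1
    · rw [show x = de from dext hb hc' rfl rfl h]
      exact hde
    · rw [show x = -de from dext hb hc' (by simp [de, mk01]) (by simp [de, mk10])
        (by simpa [de, mk00] using h)]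
      exact neg_comm_mem h1 hde
  have hent' : ∀ x ∈ H, x 0 1 = 0 → x 1 0 = 0 →
      (x 0 0 = 1 ∨ x 0 0 = -1 ∨ x 0 0 = 4 ∨ x 0 0 = -4) := by
    intro x hx hb hc'
    rcases diag4 hno hx hb hc' with h | h | h | h
    · left; rw [h]; simp
    · right; left; rw [h]; simp
    · right; right; left; rw [h]; rfl
    · right; right; right; rw [h, n_]; rfl
  have sqd : ∀ x : ZMod 17, (x = 1 ∨ x = -1 ∨ x = 4 ∨ x = -4) →
      (x ^ 2 = 1 ∨ x ^ 2 = -1) := by decide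
  have sqd2 : ∀ x : ZMod 17, (x = 1 ∨ x = -1 ∨ x = 4 ∨ x = -4) →
      ((2 * x) ^ 2 = 4 ∨ (2 * x) ^ 2 = -4) := by decide
  apply not_pronormal r1
  · intro he
    have hz' := hz
    rw [← he, mem_conj] at hz'
    have hm := H.mul_mem (H.inv_mem hz) hz'
    have d := dt z
    rw [z0, z1] at d
    have := hent' _ hm
      (by simp only [e00, e01, e10, e11, i00, i01, i10, i11, r1, mk00, mk01, mk10, mk11, z0, z1]
          ring)
      (by simp only [e00, e01, e10, e11, i00, i01, i10, i11, r1, mk00, mk01, mk10, mk11, z0, z1]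
          ring)
    have e2 : (z⁻¹ * (r1 * z * r1⁻¹)) 0 0 = 2 := by
      simp only [e00, e01, e10, e11, i00, i01, i10, i11, r1, mk00, mk01, mk10, mk11, z0, z1]
      linear_combination 36 * d + 2 * seventeen
    rw [e2] at this
    revert this
    decide
  · intro h hh x hx
    have hw : r1⁻¹ * h * r1 ∈ S2 := by
      have hr : r1 ∈ S2 := Or.inl ⟨rfl, rfl⟩
      exact S2.mul_mem (S2.mul_mem (S2.inv_mem hr) (hS hh)) hr
    obtain ⟨a, b, c⟩ := comm_entry hw (hS hx)
    have hwc : ∀ w : SL, w * x * w⁻¹ = (w * x * w⁻¹ * x⁻¹) * x := by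
      intro w; simp
    rw [hwc]
    refine H.mul_mem (hent _ a b ?_) hx
    rcases c with ⟨-, -, c⟩ | ⟨c1, c2, -, -, c⟩ | ⟨-, c1, c2, c⟩ | ⟨c1, c2, c3, c4, c⟩
    · left; exact c
    · rw [c]
      have e0 : (r1⁻¹ * h * r1) 0 0 = h 0 0 := by
        simp only [e00, e01, e10, e11, i00, i01, i10, i11, r1, mk00, mk01, mk10, mk11]
        linear_combination (h 0 0) * seventeen
      have f1 : h 0 1 = 0 := by
        simp only [e00, e01, e10, e11, i00, i01, i10, i11, r1, mk00, mk01, mk10, mk11] at c1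
        linear_combination -8 * c1 + 17 * h 0 1 * seventeen
      have f2 : h 1 0 = 0 := by
        simp only [e00, e01, e10, e11, i00, i01, i10, i11, r1, mk00, mk01, mk10, mk11] at c2
        linear_combination 2 * c2 - h 1 0 * seventeen
      rw [e0]
      rcases sqd _ (hent' h hh f1 f2) with h | h <;> rw [h] <;> decide
    · rw [c]
      have := hent' x⁻¹ (H.inv_mem hx) (by rw [i01, c1, neg_zero]) (by rw [i10, c2, neg_zero])
      rw [i00] at this
      rcases sqd _ this with h | h <;> rw [h] <;> decide
    · rw [c]
      have f1 : h 0 0 = 0 := by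
        simp only [e00, e01, e10, e11, i00, i01, i10, i11, r1, mk00, mk01, mk10, mk11] at c1
        linear_combination c1 - h 0 0 * seventeen
      have f2 : h 1 1 = 0 := by
        simp only [e00, e01, e10, e11, i00, i01, i10, i11, r1, mk00, mk01, mk10, mk11] at c2
        linear_combination c2 - h 1 1 * seventeen
      have e0 : (r1⁻¹ * h * r1) 0 1 * x 1 0 = 2 * (h * x) 0 0 := by
        simp only [e00, e01, e10, e11, i00, i01, i10, i11, r1, mk00, mk01, mk10, mk11, f1]
        linear_combination (2 * h 0 1 * x 1 0) * seventeen
      have := hent' _ (H.mul_mem hh hx) (by rw [e01, f1, c4]; ring) (by rw [e10, f2, c3]; ring)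
      rw [e0]
      rcases sqd2 _ this with h | h <;> rw [h] <;> decide

theorem case4 {H : Subgroup SL} (hS : H ≤ S2) (h1 : (-1 : SL) ∈ H) (hc : Nat.card H = 4) :
    ¬ IsPronormal H := by
  have ht : ∃ t ∈ H, t ≠ 1 ∧ t ≠ -1 := by
    by_contra hcon
    push Not at hcon
    have := card_le_list (H := H) [1, -1] (by
      intro x hx
      by_cases h : x = 1
      · simp [h]
      · simp [hcon x hx h])
    simp at this
    omega
  obtain ⟨t, ht, t1, t2⟩ := ht
  have ht4 : t ^ 4 = 1 := by
    have := pow_card_eq_one' (x := (⟨t, ht⟩ : H))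
    rw [hc] at this
    simpa using congrArg Subtype.val this
  have htsq : t ^ 2 = -1 := by
    rcases sq_one (t ^ 2) (by rw [← pow_add]; exact ht4) with h | h
    · rcases sq_one t (by rw [← pow_two]; exact h) with h | h
      · exact absurd h t1
      · exact absurd h t2
    · exact h
  have ho : orderOf t = 2 ^ 2 := by
    apply orderOf_eq_prime_pow
    · rw [pow_one, htsq]
      decide
    · exact ht4
  have hH : Subgroup.zpowers t = H := by
    apply Subgroup.eq_of_le_of_card_ge
    · rw [Subgroup.zpowers_le]; exact ht
    · rw [Nat.card_zpowers, ho, hc]; norm_num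
  have hall : ∀ x ∈ H, x = 1 ∨ x = -1 ∨ x = t ∨ x = -t := by
    intro x hx
    rw [← hH, mem_zpowers_iff_mem_range_orderOf, ho] at hx
    simp only [Finset.mem_image, Finset.mem_range] at hx
    obtain ⟨n, hn, rfl⟩ := hx
    interval_cases n
    · simp
    · simp
    · simp [htsq]
    · right; right; right
      rw [pow_succ, htsq]; simp
  have key : ∀ g : SL, (g⁻¹ * t * g) * t = -(t * (g⁻¹ * t * g)) → ¬ IsPronormal H := by
    intro g hg
    apply not_pronormal g
    · intro he
      have hs : g⁻¹ * t * g ∈ H := by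
        rw [← he, mem_conj]
        simpa [mul_assoc] using ht
      have hcm : (g⁻¹ * t * g) * t = t * (g⁻¹ * t * g) := by
        rcases hall _ hs with h | h | h | h <;> rw [h] <;> simp
      rw [hcm] at hg
      have h3 : ∀ w : SL, w ≠ -w := by
        intro w hw
        have h4 : w * 1 = w * (-1) := by simpa using hw
        have h5 := mul_left_cancel h4
        exact absurd h5 (by decide)
      exact h3 _ hg
    · intro h hh z hz
      have e : (g⁻¹ * h * g) * z = z * (g⁻¹ * h * g) ∨
          (g⁻¹ * h * g) * z = -z * (g⁻¹ * h * g) := by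
        rcases hall _ hh with h | h | h | h <;> rcases hall _ hz with h' | h' | h' | h' <;>
          simp [h, h', hg]
      rcases e with e | e
      · rw [e, mul_inv_cancel_right]; exact hz
      · rw [e, mul_inv_cancel_right]; exact neg_comm_mem h1 hz
  have hno : ∀ h ∈ H, h ^ 4 ≠ -1 := by
    intro h hh
    have := pow_card_eq_one' (x := (⟨h, hh⟩ : H))
    rw [hc] at this
    have h2 : h ^ 4 = 1 := by simpa using congrArg Subtype.val this
    rw [h2]
    decide
  rcases hS ht with ⟨a, b⟩ | ⟨a, b⟩
  · apply key (mk 1 13 15 9 (by decide))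
    rcases diag4 hno ht a b with h | h | h | h
    · exact absurd h t1
    · exact absurd h t2
    · rw [h]; decide
    · rw [h]; decide
  · apply key (mk 2 0 0 9 (by decide))
    apply sext <;>
    simp only [e00, e01, e10, e11, i00, i01, i10, i11, mk00, mk01, mk10, mk11, n_, a, b]
    · linear_combination 5 * t 0 1 * t 1 0 * seventeen
    · ring
    · ring
    · linear_combination 5 * t 0 1 * t 1 0 * seventeen

end P17

namespace P17

/-- Coded two by two matrices modulo 17. -/
structure C where
  a : ℕ
  b : ℕ
  c : ℕ
  d : ℕ

namespace C
/-- Product of coded matrices. -/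
def mul (x y : C) : C :=
  ⟨(x.a * y.a + x.b * y.c) % 17, (x.a * y.b + x.b * y.d) % 17,
   (x.c * y.a + x.d * y.c) % 17, (x.c * y.b + x.d * y.d) % 17⟩
/-- Inverse of a coded matrix of determinant one. -/
def inv (x : C) : C := ⟨x.d, (16 * x.b) % 17, (16 * x.c) % 17, x.a⟩
/-- Opposite of a coded matrix. -/
def neg (x : C) : C := ⟨(16 * x.a) % 17, (16 * x.b) % 17, (16 * x.c) % 17, (16 * x.d) % 17⟩
/-- Boolean equality. -/
def eqb (x y : C) : Bool :=
  Nat.beq x.a y.a && (Nat.beq x.b y.b && (Nat.beq x.c y.c && Nat.beq x.d y.d))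
/-- Evaluate all entries before continuing. -/
def force (x : C) (f : C → Bool) : Bool :=
  Nat.rec (motive := fun _ => (ℕ → Bool) → Bool) (fun h => h 0) (fun m _ h => h (m + 1)) x.a fun a =>
  Nat.rec (motive := fun _ => (ℕ → Bool) → Bool) (fun h => h 0) (fun m _ h => h (m + 1)) x.b fun b =>
  Nat.rec (motive := fun _ => (ℕ → Bool) → Bool) (fun h => h 0) (fun m _ h => h (m + 1)) x.c fun c =>
  Nat.rec (motive := fun _ => (ℕ → Bool) → Bool) (fun h => h 0) (fun m _ h => h (m + 1)) x.d fun d =>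
  f ⟨a, b, c, d⟩
/-- Membership in a list. -/
def mem (x : C) (l : List C) : Bool := l.any (fun y => eqb x y)
/-- The element is, up to sign, unipotent and it is not central. -/
def unip (x : C) : Bool :=
  (Nat.beq ((x.a + x.d) % 17) 2 || Nat.beq ((x.a + x.d) % 17) 15) &&
    !(Nat.beq (x.b % 17) 0 && Nat.beq (x.c % 17) 0)
/-- Normalizer of the non-split torus. -/
def inN (x : C) : Bool :=
  (Nat.beq x.a x.d && Nat.beq x.b ((3 * x.c) % 17)) ||
  (Nat.beq ((x.a + x.d) % 17) 0 && Nat.beq ((x.b + 3 * x.c) % 17) 0)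
end C
open C

/-- Identity. -/
def one : C := ⟨1, 0, 0, 1⟩
/-- Element of order three. -/
def k : C := ⟨8, 6, 2, 8⟩
/-- Inverse of `k`. -/
def k2 : C := ⟨8, 11, 15, 8⟩
/-- Generators of the six quaternion groups normalized by `k`. -/
def vs : ℕ → C
  | 0 => ⟨0, 2, 8, 0⟩
  | 1 => ⟨0, 7, 12, 0⟩
  | 2 => ⟨4, 0, 3, 13⟩
  | 3 => ⟨4, 0, 14, 13⟩
  | 4 => ⟨4, 8, 0, 13⟩
  | _ => ⟨4, 9, 0, 13⟩
/-- Elements extending the binary tetrahedral groups to binary octahedral ones. -/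
def ms : ℕ → C
  | 0 => ⟨2, 7, 9, 15⟩
  | 1 => ⟨2, 7, 9, 15⟩
  | 2 => ⟨3, 9, 14, 14⟩
  | 3 => ⟨3, 8, 3, 14⟩
  | 4 => ⟨3, 9, 14, 14⟩
  | _ => ⟨3, 8, 3, 14⟩
/-- Noncentral elements of the quaternion group, up to sign. -/
def qH (v : C) : List C := [v, mul (mul k v) k2, mul (mul k2 v) k]
/-- Quaternion group, up to sign. -/
def qL (v : C) : List C := one :: qH v
/-- Add the opposites. -/
def pm (l : List C) : List C := l ++ l.map neg
/-- The binary tetrahedral group. -/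
def aL (v : C) : List C :=
  pm (qL v ++ ((qL v).map (fun x => mul x k) ++ (qL v).map (fun x => mul x k2)))
/-- The rest of the binary octahedral group. -/
def mL (v m : C) : List C := (aL v).map (fun x => mul x m)

/-- Words used to find unipotent elements. -/
def ws : List (List ℕ) :=
  [[0], [1], [2], [0, 1], [1, 2], [0, 2], [0, 2, 1], [1, 1, 2], [0, 2, 2], [0, 0, 1],
   [0, 1, 2, 2], [0, 2, 1, 1], [0, 0, 2, 1], [0, 0, 0, 1, 2], [0, 2, 1, 2, 2], [0, 1, 1, 2, 1],
   [0, 1, 0, 1, 2], [0, 2, 0, 2, 1], [1, 1, 2, 2, 1, 2], [0, 0, 2, 0, 2, 2], [0, 0, 1, 1, 0, 1],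
   [0, 0, 0, 2, 0, 2, 2], [0, 0, 0, 1, 0, 1, 1], [1, 1, 1, 2, 1, 2, 2]]
/-- Select. -/
def sel (x y z : C) : ℕ → C
  | 0 => x
  | 1 => y
  | _ => z
/-- Test a word for being unipotent. -/
def tw (x y z : C) : C → List ℕ → Bool
  | acc, [] => unip acc
  | acc, t :: l => force (mul acc (sel x y z t)) (fun acc' => tw x y z acc' l)
/-- Does some word give a unipotent element? -/
def tws (x : C) : Bool :=
  force (mul x k) fun y => force (mul x k2) fun z => ws.any (fun w => tw x y z one w)
/-- Quaternion generators obtained from words. -/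
def gv (x v : C) : Bool :=
  mem x (pm (qH v)) || (mem (mul x x) (pm (qH v)) ||
   (mem (mul (mul k x) (mul k2 (inv x))) (pm (qH v)) ||
    mem (mul (mul x k) (mul x k)) (pm (qH v))))
/-- The binary octahedral group. -/
def oL (i : ℕ) : List C := aL (vs i) ++ mL (vs i) (ms i)
/-- The main check for one element. -/
def chk (x : C) : Bool :=
  inN x || (tws x || (List.range 6).any (fun i => gv x (vs i) && mem x (oL i)))
/-- Representatives of first columns modulo the action of the group generated by `k` and `-1`. -/
def reps : List ℕ :=
  [
   1, 2, 3, 4, 5, 6, 7, 8, 17, 18, 19, 20, 21, 22, 23, 25, 26, 28, 29, 31, 32, 33, 35, 36,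
   38, 39, 41, 42, 44, 46, 47, 49, 50, 51, 54, 56, 57, 59, 60, 62, 65, 69, 72, 75, 78, 81,
   85, 88]
/-- Membership of a column in the list of representatives. -/
def isRep (a c : ℕ) : Bool := reps.any (fun n => Nat.beq n (a * 17 + c))
/-- Run over all matrices of determinant one. -/
def allG (f : C → Bool) : Bool :=
  (List.range 17).all fun a => (List.range 17).all fun c => !(isRep a c) ||
  (List.range 17).all fun b => (List.range 17).all fun d =>
   !(Nat.beq ((a * d + 16 * (b * c)) % 17) 1) || f ⟨a, b, c, d⟩
/-- Some translate of the first column is a representative. -/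
def rp (x : C) : Bool := isRep x.a x.c
/-- Covering test. -/
def cov (x : C) : Bool :=
  rp x || (rp (neg x) || (rp (mul k x) || (rp (neg (mul k x)) ||
    (rp (mul k2 x) || rp (neg (mul k2 x))))))
/-- Every column is covered. -/
def covAll : Bool :=
  (List.range 17).all fun a => (List.range 17).all fun c =>
    (Nat.beq a 0 && Nat.beq c 0) || cov ⟨a, 0, c, 0⟩
/-- Elements of the normalizer outside the octahedral group generate everything. -/
def chk2 (x : C) : Bool :=
  (List.range 6).all fun i => mem x (oL i) ||
    (qL (vs i)).any fun q => (aL (vs i)).any fun y => unip (mul (mul (mul x q) (inv x)) y)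
/-- Run over the normalizer. -/
def allN (f : C → Bool) : Bool :=
  (List.range 17).all fun a => (List.range 17).all fun c =>
    (!(Nat.beq ((a * a + 16 * ((3 * c) * c)) % 17) 1) || f ⟨a, (3 * c) % 17, c, a⟩) &&
    (!(Nat.beq ((16 * (a * a) + 3 * (c * c)) % 17) 1) || f ⟨a, (14 * c) % 17, c, (16 * a) % 17⟩)
/-- Two different quaternion groups generate everything. -/
def chk3 : Bool :=
  (List.range 6).all fun i => (List.range 6).all fun l => Nat.beq i l ||
    (aL (vs l)).any fun y => unip (mul (mul (mul (vs i) (vs l)) (vs i)) y)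
/-- Any noncentral quaternion generates. -/
def chk4 : Bool :=
  (List.range 6).all fun i => (pm (qH (vs i))).all fun v => (aL (vs i)).all fun y => mem y (aL v)
/-- Closure. -/
def chk5 : Bool :=
  (List.range 6).all fun i => (oL i).all fun y => mem (mul k y) (oL i) && mem (neg y) (oL i)

set_option maxRecDepth 100000 in
theorem run1 : allG chk = true := by decide +kernel
set_option maxRecDepth 100000 in
theorem runc : covAll = true := by decide +kernel
set_option maxRecDepth 100000 in
theorem run2 : allN chk2 = true := by decide +kernel
set_option maxRecDepth 100000 in
theorem run3 : chk3 = true := by decide +kernel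
set_option maxRecDepth 100000 in
theorem run4 : chk4 = true := by decide +kernel
set_option maxRecDepth 100000 in
theorem run5 : chk5 = true := by decide +kernel

end P17

namespace P17
open C

/-- The order three element. -/
def kk : SL := mk 8 6 2 8 (by decide)

theorem top_of_unip {J : Subgroup SL} (hk : kk ∈ J) (h1 : (-1 : SL) ∈ J) {g : SL} (hg : g ∈ J)
    (ht : g 0 0 + g 1 1 = 2 ∨ g 0 0 + g 1 1 = -2) (hne : ¬ (g 0 1 = 0 ∧ g 1 0 = 0)) : J = ⊤ := by
  have main : ∀ g ∈ J, g 0 0 + g 1 1 = 2 → ¬ (g 0 1 = 0 ∧ g 1 0 = 0) → J = ⊤ := by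
    intro g hg ht hne
    obtain ⟨y, t, ht0, hy⟩ := unip_conj g ht hne
    have hu : up t ∈ J.conjugate y := by
      rw [mem_conj, ← hy]
      simpa [mul_assoc] using hg
    have hh : y⁻¹ * kk * y ∈ J.conjugate y := by
      rw [mem_conj]
      simpa [mul_assoc] using hk
    have hc : (y⁻¹ * kk * y) 1 0 ≠ 0 := by
      intro h0
      have h2 := tr_conj kk y⁻¹
      rw [inv_inv] at h2
      have h3 := dt (y⁻¹ * kk * y)
      rw [h0] at h3
      have h4 : kk 0 0 + kk 1 1 = -1 := by decide
      rw [h4] at h2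
      have key : ∀ a d : ZMod 17, a + d = -1 → a * d ≠ 1 := by decide
      exact key _ _ h2 (by linear_combination h3)
    have htop := top_of_up (up_all ht0 hu) hh hc
    rw [eq_top_iff]
    intro x _
    have : y⁻¹ * x * y ∈ J.conjugate y := by rw [htop]; trivial
    rw [mem_conj] at this
    simpa [mul_assoc] using this
  rcases ht with ht | ht
  · exact main g hg ht hne
  · refine main (-g) (neg_comm_mem h1 hg) ?_ ?_
    · rw [n_, n_]; linear_combination -ht
    · rw [n_, n_]; simpa using hne

/-- The group element `g` is represented by the code `x`. -/
def R (g : SL) (x : C) : Prop :=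
  g 0 0 = (x.a : ZMod 17) ∧ g 0 1 = (x.b : ZMod 17) ∧ g 1 0 = (x.c : ZMod 17) ∧
    g 1 1 = (x.d : ZMod 17)

theorem R.ext {g h : SL} {x : C} (hg : R g x) (hh : R h x) : g = h := by
  obtain ⟨a, b, c, d⟩ := hg
  obtain ⟨a', b', c', d'⟩ := hh
  apply sext
  · rw [a, a']
  · rw [b, b']
  · rw [c, c']
  · rw [d, d']

theorem sixteen : (16 : ZMod 17) = -1 := by decide

theorem R.mul {g h : SL} {x y : C} (hg : R g x) (hh : R h y) : R (g * h) (C.mul x y) := by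
  obtain ⟨a, b, c, d⟩ := hg
  obtain ⟨a', b', c', d'⟩ := hh
  refine ⟨?_, ?_, ?_, ?_⟩ <;>
    simp only [e00, e01, e10, e11, a, b, c, d, a', b', c', d', C.mul, ZMod.natCast_mod,
      Nat.cast_add, Nat.cast_mul]

theorem R.inv {g : SL} {x : C} (hg : R g x) : R g⁻¹ (C.inv x) := by
  obtain ⟨a, b, c, d⟩ := hg
  refine ⟨?_, ?_, ?_, ?_⟩ <;>
    simp [i00, i01, i10, i11, a, b, c, d, C.inv, ZMod.natCast_mod, sixteen]

theorem R.neg {g : SL} {x : C} (hg : R g x) : R (-g) (C.neg x) := by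
  obtain ⟨a, b, c, d⟩ := hg
  refine ⟨?_, ?_, ?_, ?_⟩ <;>
    simp only [n_, a, b, c, d, C.neg, ZMod.natCast_mod, Nat.cast_mul, Nat.cast_ofNat, sixteen] <;>
    ring

theorem R_one : R 1 one := by
  refine ⟨?_, ?_, ?_, ?_⟩ <;> simp [one]

theorem R_kk : R kk k := by
  refine ⟨?_, ?_, ?_, ?_⟩ <;> decide

theorem R_kk2 : R kk⁻¹ k2 := by
  refine ⟨?_, ?_, ?_, ?_⟩ <;> decide

theorem eqb_eq {x y : C} (h : eqb x y = true) : x = y := by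
  obtain ⟨a, b, c, d⟩ := x
  obtain ⟨a', b', c', d'⟩ := y
  simp only [eqb, Bool.and_eq_true, Nat.beq_eq] at h
  obtain ⟨h1, h2, h3, h4⟩ := h
  subst h1 h2 h3 h4
  rfl

theorem mem_mem {x : C} {l : List C} (h : mem x l = true) : x ∈ l := by
  rw [mem, List.any_eq_true] at h
  obtain ⟨y, hy, hxy⟩ := h
  rw [eqb_eq hxy]
  exact hy

theorem force_eq (x : C) (f : C → Bool) : force x f = f x := by
  obtain ⟨a, b, c, d⟩ := x
  cases a <;> cases b <;> cases c <;> cases d <;> rfl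

/-- The code `x` represents an element of `J`. -/
def IJ (J : Subgroup SL) (x : C) : Prop := ∃ g ∈ J, R g x

theorem IJ.mul {J : Subgroup SL} {x y : C} (hx : IJ J x) (hy : IJ J y) : IJ J (C.mul x y) := by
  obtain ⟨g, hg, hgx⟩ := hx
  obtain ⟨h, hh, hhy⟩ := hy
  exact ⟨g * h, J.mul_mem hg hh, hgx.mul hhy⟩

theorem IJ.inv {J : Subgroup SL} {x : C} (hx : IJ J x) : IJ J (C.inv x) := by
  obtain ⟨g, hg, hgx⟩ := hx
  exact ⟨g⁻¹, J.inv_mem hg, hgx.inv⟩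

theorem IJ.mem {J : Subgroup SL} {g : SL} {x : C} (hx : IJ J x) (hg : R g x) : g ∈ J := by
  obtain ⟨h, hh, hhx⟩ := hx
  rw [hg.ext hhx]
  exact hh

theorem IJ_unip {J : Subgroup SL} (hk : kk ∈ J) (h1 : (-1 : SL) ∈ J) {x : C} (hx : IJ J x)
    (hu : unip x = true) : J = ⊤ := by
  obtain ⟨g, hg, a, b, c, d⟩ := hx
  simp only [unip, Bool.and_eq_true, Bool.or_eq_true, Nat.beq_eq, Bool.not_eq_true',
    Bool.and_eq_false_iff] at hu
  obtain ⟨h2, h3⟩ := hu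
  refine top_of_unip hk h1 hg ?_ ?_
  · rcases h2 with h | h
    · left
      have := (ZMod.natCast_eq_natCast_iff' (x.a + x.d) 2 17).2 h
      rw [a, d]
      exact_mod_cast this
    · right
      have := (ZMod.natCast_eq_natCast_iff' (x.a + x.d) 15 17).2 h
      rw [a, d, ← Nat.cast_add, this]
      decide
  · rintro ⟨hb, hc⟩
    rw [b, ZMod.natCast_eq_zero_iff, Nat.dvd_iff_mod_eq_zero] at hb
    rw [c, ZMod.natCast_eq_zero_iff, Nat.dvd_iff_mod_eq_zero] at hc
    rw [hb, hc] at h3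
    simp at h3

end P17

namespace P17
open C

theorem IJ_neg {J : Subgroup SL} (h1 : (-1 : SL) ∈ J) {x : C} (hx : IJ J x) : IJ J (C.neg x) := by
  obtain ⟨g, hg, hgx⟩ := hx
  exact ⟨-g, neg_comm_mem h1 hg, hgx.neg⟩

theorem IJ_k {J : Subgroup SL} (hk : kk ∈ J) : IJ J k := ⟨kk, hk, R_kk⟩
theorem IJ_k2 {J : Subgroup SL} (hk : kk ∈ J) : IJ J k2 := ⟨kk⁻¹, J.inv_mem hk, R_kk2⟩
theorem IJ_one {J : Subgroup SL} : IJ J one := ⟨1, J.one_mem, R_one⟩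

theorem IJ_pm {J : Subgroup SL} (h1 : (-1 : SL) ∈ J) {l : List C} (h : ∀ x ∈ l, IJ J x) :
    ∀ x ∈ pm l, IJ J x := by
  intro x hx
  rw [pm, List.mem_append, List.mem_map] at hx
  rcases hx with hx | ⟨y, hy, rfl⟩
  · exact h x hx
  · exact IJ_neg h1 (h y hy)

theorem IJ_qL {J : Subgroup SL} (hk : kk ∈ J) {v : C} (hv : IJ J v) : ∀ x ∈ qL v, IJ J x := by
  intro x hx
  simp only [qL, qH, List.mem_cons, List.not_mem_nil, or_false] at hx
  rcases hx with rfl | rfl | rfl | rfl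
  · exact IJ_one
  · exact hv
  · exact ((IJ_k hk).mul hv).mul (IJ_k2 hk)
  · exact ((IJ_k2 hk).mul hv).mul (IJ_k hk)

theorem IJ_aL {J : Subgroup SL} (hk : kk ∈ J) (h1 : (-1 : SL) ∈ J) {v : C} (hv : IJ J v) :
    ∀ x ∈ aL v, IJ J x := by
  apply IJ_pm h1
  intro x hx
  simp only [List.mem_append, List.mem_map] at hx
  rcases hx with hx | ⟨y, hy, rfl⟩ | ⟨y, hy, rfl⟩
  · exact IJ_qL hk hv x hx
  · exact (IJ_qL hk hv y hy).mul (IJ_k hk)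
  · exact (IJ_qL hk hv y hy).mul (IJ_k2 hk)

theorem v_mem_aL (v : C) : v ∈ aL v := by
  simp [aL, pm, qL, qH]

theorem one_mem_aL (v : C) : one ∈ aL v := by
  simp [aL, pm, qL, qH]

theorem qL_sub_aL {v x : C} (h : x ∈ qL v) : x ∈ aL v := by
  simp only [aL, pm, List.mem_append]
  exact Or.inl (Or.inl h)

theorem IJ_tw {J : Subgroup SL} (hk : kk ∈ J) (h1 : (-1 : SL) ∈ J) {x y z : C} (hx : IJ J x)
    (hy : IJ J y) (hz : IJ J z) (l : List ℕ) (acc : C) (ha : IJ J acc)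
    (h : tw x y z acc l = true) : J = ⊤ := by
  induction l generalizing acc with
  | nil => exact IJ_unip hk h1 ha h
  | cons t l ih =>
    rw [tw, force_eq] at h
    refine ih _ (ha.mul ?_) h
    unfold sel
    split <;> assumption

theorem IJ_tws {J : Subgroup SL} (hk : kk ∈ J) (h1 : (-1 : SL) ∈ J) {x : C} (hx : IJ J x)
    (h : tws x = true) : J = ⊤ := by
  rw [tws, force_eq, force_eq, List.any_eq_true] at h
  obtain ⟨w, -, hw⟩ := h
  exact IJ_tw hk h1 hx (hx.mul (IJ_k hk)) (hx.mul (IJ_k2 hk)) w one IJ_one hw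

theorem IJ_gv {J : Subgroup SL} (hk : kk ∈ J) (h1 : (-1 : SL) ∈ J) {x : C} (hx : IJ J x) {i : ℕ}
    (hi : i < 6) (h : gv x (vs i) = true) : ∀ y ∈ aL (vs i), IJ J y := by
  have h4 := run4
  rw [chk4, List.all_eq_true] at h4
  have h5 := h4 i (List.mem_range.2 hi)
  rw [List.all_eq_true] at h5
  have key : ∀ w, IJ J w → w ∈ pm (qH (vs i)) → ∀ y ∈ aL (vs i), IJ J y := by
    intro w hw hwm y hy
    have h6 := h5 w hwm
    rw [List.all_eq_true] at h6
    exact IJ_aL hk h1 hw y (mem_mem (h6 y hy))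
  simp only [gv, Bool.or_eq_true] at h
  rcases h with h | h | h | h
  · exact key _ hx (mem_mem h)
  · exact key _ (hx.mul hx) (mem_mem h)
  · exact key _ (((IJ_k hk).mul hx).mul ((IJ_k2 hk).mul hx.inv)) (mem_mem h)
  · exact key _ ((hx.mul (IJ_k hk)).mul (hx.mul (IJ_k hk))) (mem_mem h)

/-- The group element is represented by an element of the list. -/
def In (l : List C) (g : SL) : Prop := ∃ x ∈ l, R g x

/-- Code of a group element. -/
def code (g : SL) : C := ⟨(g 0 0).val, (g 0 1).val, (g 1 0).val, (g 1 1).val⟩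

theorem R_code (g : SL) : R g (code g) := by
  refine ⟨?_, ?_, ?_, ?_⟩ <;> simp [code]

theorem val_lt (a : ZMod 17) : a.val < 17 := ZMod.val_lt a

theorem code_det (g : SL) :
    ((g 0 0).val * (g 1 1).val + 16 * ((g 0 1).val * (g 1 0).val)) % 17 = 1 := by
  have h := dt g
  have := (ZMod.natCast_eq_natCast_iff'
    ((g 0 0).val * (g 1 1).val + 16 * ((g 0 1).val * (g 1 0).val)) 1 17).1 (by
      push_cast
      rw [ZMod.natCast_zmod_val, ZMod.natCast_zmod_val, ZMod.natCast_zmod_val,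
        ZMod.natCast_zmod_val, sixteen]
      linear_combination h)
  simpa using this

theorem chk_code (g : SL) (h : rp (code g) = true) : chk (code g) = true := by
  have h0 := run1
  simp only [allG, List.all_eq_true, List.mem_range, Bool.or_eq_true, Bool.not_eq_true'] at h0
  rcases h0 _ (val_lt (g 0 0)) _ (val_lt (g 1 0)) with h2 | h2
  · rw [rp] at h
    simp only [code] at h
    rw [h2] at h
    exact absurd h (by decide)
  · rcases h2 _ (val_lt (g 0 1)) _ (val_lt (g 1 1)) with h3 | h3
    · rw [code_det g] at h3
      exact absurd h3 (by decide)
    · exact h3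

/-- The normalizer of the non-split torus, as a set. -/
def MN (g : SL) : Prop :=
  (g 1 1 = g 0 0 ∧ g 0 1 = 3 * g 1 0) ∨ (g 1 1 = - g 0 0 ∧ g 0 1 = - (3 * g 1 0))

theorem inN_MN {g : SL} {x : C} (hg : R g x) (h : inN x = true) : MN g := by
  obtain ⟨a, b, c, d⟩ := hg
  simp only [inN, Bool.or_eq_true, Bool.and_eq_true, Nat.beq_eq] at h
  rcases h with ⟨h1, h2⟩ | ⟨h1, h2⟩
  · left
    rw [a, b, c, d, h1, h2]
    simp
  · right
    have h3 := (ZMod.natCast_eq_zero_iff _ _).2 (Nat.dvd_of_mod_eq_zero h1)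
    have h4 := (ZMod.natCast_eq_zero_iff _ _).2 (Nat.dvd_of_mod_eq_zero h2)
    push_cast at h3 h4
    rw [a, b, c, d]
    exact ⟨by linear_combination h3, by linear_combination h4⟩

/-- Conclusion for one element. -/
def Good (J : Subgroup SL) (g : SL) : Prop :=
  J = ⊤ ∨ MN g ∨ ∃ i < 6, (∀ y ∈ aL (vs i), IJ J y) ∧ In (oL i) g

theorem good_rep {J : Subgroup SL} (hk : kk ∈ J) (h1 : (-1 : SL) ∈ J) {g : SL} (hg : g ∈ J)
    (h : rp (code g) = true) : Good J g := by
  have hc := chk_code g h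
  have hx : IJ J (code g) := ⟨g, hg, R_code g⟩
  simp only [chk, Bool.or_eq_true, List.any_eq_true, List.mem_range, Bool.and_eq_true] at hc
  rcases hc with hc | hc | ⟨i, hi, hc, hm⟩
  · exact Or.inr (Or.inl (inN_MN (R_code g) hc))
  · exact Or.inl (IJ_tws hk h1 hx hc)
  · exact Or.inr (Or.inr ⟨i, hi, IJ_gv hk h1 hx hi hc, _, mem_mem hm, R_code g⟩)

theorem oL_k {i : ℕ} (hi : i < 6) {g : SL} (h : In (oL i) g) : In (oL i) (kk * g) := by
  obtain ⟨x, hx, hr⟩ := h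
  have h5 := run5
  simp only [chk5, List.all_eq_true, List.mem_range, Bool.and_eq_true] at h5
  exact ⟨_, mem_mem (h5 i hi x hx).1, R_kk.mul hr⟩

theorem oL_neg {i : ℕ} (hi : i < 6) {g : SL} (h : In (oL i) g) : In (oL i) (-g) := by
  obtain ⟨x, hx, hr⟩ := h
  have h5 := run5
  simp only [chk5, List.all_eq_true, List.mem_range, Bool.and_eq_true] at h5
  exact ⟨_, mem_mem (h5 i hi x hx).2, hr.neg⟩

theorem MN_k {g : SL} (h : MN g) : MN (kk * g) := by
  have h00 : kk 0 0 = 8 := rfl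
  have h01 : kk 0 1 = 6 := rfl
  have h10 : kk 1 0 = 2 := rfl
  have h11 : kk 1 1 = 8 := rfl
  rcases h with ⟨a, b⟩ | ⟨a, b⟩
  · left
    simp only [e00, e01, e10, e11, h00, h01, h10, h11, a, b]
    constructor <;> ring
  · right
    simp only [e00, e01, e10, e11, h00, h01, h10, h11, a, b]
    constructor <;> ring

theorem MN_neg {g : SL} (h : MN g) : MN (-g) := by
  rcases h with ⟨a, b⟩ | ⟨a, b⟩
  · left
    simp only [n_, a, b]
    exact ⟨trivial, by ring⟩
  · right
    simp only [n_, a, b]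
    exact ⟨trivial, by ring⟩

theorem Good.k {J : Subgroup SL} {g : SL} (h : Good J g) : Good J (kk * g) := by
  rcases h with h | h | ⟨i, hi, ha, h⟩
  · exact Or.inl h
  · exact Or.inr (Or.inl (MN_k h))
  · exact Or.inr (Or.inr ⟨i, hi, ha, oL_k hi h⟩)

theorem Good.neg {J : Subgroup SL} {g : SL} (h : Good J g) : Good J (-g) := by
  rcases h with h | h | ⟨i, hi, ha, h⟩
  · exact Or.inl h
  · exact Or.inr (Or.inl (MN_neg h))
  · exact Or.inr (Or.inr ⟨i, hi, ha, oL_neg hi h⟩)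

theorem Good.of_neg {J : Subgroup SL} {g : SL} (h : Good J (-g)) : Good J g := by
  simpa using h.neg

theorem kk3 : kk * (kk * kk) = 1 := by decide
theorem kk_inv : kk⁻¹ = kk * kk := by decide

theorem Good.of_k {J : Subgroup SL} {g : SL} (h : Good J (kk * g)) : Good J g := by
  have := h.k.k
  rwa [← mul_assoc kk kk g, ← mul_assoc, kk3, one_mul] at this

/-- The column test only depends on the first column. -/
theorem rp_code {g : SL} {x : C} (hg : R g x) (ha : x.a < 17) (hc : x.c < 17)
    (h : rp x = true) : rp (code g) = true := by
  obtain ⟨a, b, c, d⟩ := hg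
  rw [rp] at h ⊢
  simp only [code, a, c]
  rw [ZMod.val_natCast_of_lt ha, ZMod.val_natCast_of_lt hc]
  exact h

theorem cov_code (g : SL) : cov (code g) = true := by
  have h0 := runc
  simp only [covAll, List.all_eq_true, List.mem_range, Bool.or_eq_true, Bool.and_eq_true,
    Nat.beq_eq] at h0
  rcases h0 _ (val_lt (g 0 0)) _ (val_lt (g 1 0)) with ⟨h1, h2⟩ | h
  · have := code_det g
    rw [h1, h2] at this
    simp at this
  · rw [← h]
    rfl

theorem good_all {J : Subgroup SL} (hk : kk ∈ J) (h1 : (-1 : SL) ∈ J) {g : SL} (hg : g ∈ J) :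
    Good J g := by
  have h := cov_code g
  have r := R_code g
  have lt : ∀ n : ℕ, n % 17 < 17 := fun n => Nat.mod_lt _ (by norm_num)
  simp only [cov, Bool.or_eq_true] at h
  rcases h with h | h | h | h | h | h
  · exact good_rep hk h1 hg h
  · exact (good_rep hk h1 (neg_comm_mem h1 hg) (rp_code r.neg (lt _) (lt _) h)).of_neg
  · exact (good_rep hk h1 (J.mul_mem hk hg) (rp_code (R_kk.mul r) (lt _) (lt _) h)).of_k
  · exact (good_rep hk h1 (neg_comm_mem h1 (J.mul_mem hk hg))
      (rp_code (R_kk.mul r).neg (lt _) (lt _) h)).of_neg.of_k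
  · have := good_rep hk h1 (J.mul_mem (J.inv_mem hk) hg)
      (rp_code (R_kk2.mul r) (lt _) (lt _) h)
    rw [kk_inv, mul_assoc] at this
    exact this.of_k.of_k
  · have := (good_rep hk h1 (neg_comm_mem h1 (J.mul_mem (J.inv_mem hk) hg))
      (rp_code (R_kk2.mul r).neg (lt _) (lt _) h)).of_neg
    rw [kk_inv, mul_assoc] at this
    exact this.of_k.of_k

theorem MN_code {g : SL} (h : MN g) {f : C → Bool} (hf : allN f = true) :
    ∃ x, R g x ∧ f x = true := by
  simp only [allN, List.all_eq_true, List.mem_range, Bool.or_eq_true, Bool.and_eq_true,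
    Bool.not_eq_true'] at hf
  have hd := dt g
  have r := hf _ (val_lt (g 0 0)) _ (val_lt (g 1 0))
  rcases h with ⟨a, b⟩ | ⟨a, b⟩
  · refine ⟨_, ?_, r.1.resolve_left ?_⟩
    · refine ⟨by simp, by simp [b], by simp, by simp [a]⟩
    · rw [Bool.not_eq_false, Nat.beq_eq]
      have := (ZMod.natCast_eq_natCast_iff' ((g 0 0).val * (g 0 0).val +
        16 * ((3 * (g 1 0).val) * (g 1 0).val)) 1 17).1 (by
          push_cast
          rw [ZMod.natCast_zmod_val, ZMod.natCast_zmod_val, sixteen]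
          rw [a, b] at hd
          linear_combination hd)
      simpa using this
  · have h14 : (14 : ZMod 17) = -3 := by decide
    refine ⟨_, ?_, r.2.resolve_left ?_⟩
    · refine ⟨by simp, by simp [b, h14], by simp, by simp [a, sixteen]⟩
    · rw [Bool.not_eq_false, Nat.beq_eq]
      have := (ZMod.natCast_eq_natCast_iff' (16 * ((g 0 0).val * (g 0 0).val) +
        3 * ((g 1 0).val * (g 1 0).val)) 1 17).1 (by
          push_cast
          rw [ZMod.natCast_zmod_val, ZMod.natCast_zmod_val, sixteen]
          rw [a, b] at hd
          linear_combination hd)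
      simpa using this

theorem MN_oL {J : Subgroup SL} (hk : kk ∈ J) (h1 : (-1 : SL) ∈ J) (hJ : J ≠ ⊤) {i : ℕ}
    (hi : i < 6) (ha : ∀ y ∈ aL (vs i), IJ J y) {g : SL} (hg : g ∈ J) (hN : MN g) :
    In (oL i) g := by
  obtain ⟨x, hx, hf⟩ := MN_code hN run2
  simp only [chk2, List.all_eq_true, List.mem_range, Bool.or_eq_true, List.any_eq_true] at hf
  rcases hf i hi with h | ⟨q, hq, y, hy, hu⟩
  · exact ⟨x, mem_mem h, hx⟩
  · have hxJ : IJ J x := ⟨g, hg, hx⟩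
    exact absurd (IJ_unip hk h1 (((hxJ.mul (ha q (qL_sub_aL hq))).mul hxJ.inv).mul (ha y hy)) hu) hJ

theorem idx_eq {J : Subgroup SL} (hk : kk ∈ J) (h1 : (-1 : SL) ∈ J) (hJ : J ≠ ⊤) {i l : ℕ}
    (hi : i < 6) (hl : l < 6) (ha : ∀ y ∈ aL (vs i), IJ J y) (hb : ∀ y ∈ aL (vs l), IJ J y) :
    i = l := by
  have h3 := run3
  simp only [chk3, List.all_eq_true, List.mem_range, Bool.or_eq_true, List.any_eq_true,
    Nat.beq_eq] at h3
  rcases h3 i hi l hl with h | ⟨y, hy, hu⟩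
  · exact h
  · have hv := ha _ (v_mem_aL _)
    exact absurd (IJ_unip hk h1 (((hv.mul (hb _ (v_mem_aL _))).mul hv).mul (hb y hy)) hu) hJ

theorem lemC {J : Subgroup SL} (hk : kk ∈ J) (h1 : (-1 : SL) ∈ J) :
    J = ⊤ ∨ (∀ g ∈ J, MN g) ∨ ∃ i < 6, (∀ y ∈ aL (vs i), IJ J y) ∧ ∀ g ∈ J, In (oL i) g := by
  by_cases hJ : J = ⊤
  · exact Or.inl hJ
  by_cases hN : ∀ g ∈ J, MN g
  · exact Or.inr (Or.inl hN)
  right; right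
  push Not at hN
  obtain ⟨g, hg, hgN⟩ := hN
  rcases good_all hk h1 hg with h | h | ⟨i, hi, ha, -⟩
  · exact absurd h hJ
  · exact absurd h hgN
  refine ⟨i, hi, ha, ?_⟩
  intro x hx
  rcases good_all hk h1 hx with h | h | ⟨l, hl, hb, hm⟩
  · exact absurd h hJ
  · exact MN_oL hk h1 hJ hi ha hx h
  · rw [idx_eq hk h1 hJ hi hl ha hb]
    exact hm

end P17

namespace P17
open C

/-- The non-split torus. -/
def ST (g : SL) : Prop := g 1 1 = g 0 0 ∧ g 0 1 = 3 * g 1 0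
/-- The other coset of the non-split torus in its normalizer. -/
def SO (g : SL) : Prop := g 1 1 = - g 0 0 ∧ g 0 1 = - (3 * g 1 0)

/-- The normalizer of the torus as a subgroup. -/
def Nn : Subgroup SL where
  carrier := {g | MN g}
  one_mem' := Or.inl (by simp)
  mul_mem' := by
    intro g h hg hh
    rcases hg with ⟨a, b⟩ | ⟨a, b⟩ <;> rcases hh with ⟨c, d⟩ | ⟨c, d⟩
    · left; simp only [e00, e01, e10, e11, a, b, c, d]; constructor <;> ring
    · right; simp only [e00, e01, e10, e11, a, b, c, d]; constructor <;> ring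
    · right; simp only [e00, e01, e10, e11, a, b, c, d]; constructor <;> ring
    · left; simp only [e00, e01, e10, e11, a, b, c, d]; constructor <;> ring
  inv_mem' := by
    intro g hg
    rcases hg with ⟨a, b⟩ | ⟨a, b⟩
    · left; simp only [i00, i01, i10, i11, a, b]; exact ⟨trivial, by ring⟩
    · right; simp only [i00, i01, i10, i11, a, b]; exact ⟨by ring, by ring⟩

theorem mem_Nn {g : SL} : g ∈ Nn ↔ MN g := Iff.rfl

/-- The torus as a subgroup. -/
def Tt : Subgroup SL where
  carrier := {g | ST g}
  one_mem' := by
    constructor <;> simp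
  mul_mem' := by
    intro g h hg hh
    obtain ⟨a, b⟩ := hg
    obtain ⟨c, d⟩ := hh
    constructor
    · simp only [e00, e01, e10, e11, a, b, c, d]; ring
    · simp only [e00, e01, e10, e11, a, b, c, d]; ring
  inv_mem' := by
    intro g hg
    obtain ⟨a, b⟩ := hg
    constructor
    · simp only [i00, i01, i10, i11, a, b]
    · simp only [i00, i01, i10, i11, a, b]; ring

theorem mem_Tt {g : SL} : g ∈ Tt ↔ ST g := Iff.rfl

theorem ST_comm {x y : SL} (hx : ST x) (hy : ST y) : x * y = y * x := by
  obtain ⟨a, b⟩ := hx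
  obtain ⟨c, d⟩ := hy
  apply sext <;> simp only [e00, e01, e10, e11, a, b, c, d] <;> ring

theorem SO_ST {g x : SL} (hg : SO g) (hx : ST x) : g * x = x⁻¹ * g := by
  obtain ⟨a, b⟩ := hg
  obtain ⟨c, d⟩ := hx
  apply sext <;> simp only [e00, e01, e10, e11, i00, i01, i10, i11, a, b, c, d] <;> ring

theorem SO_SO {g s : SL} (hg : SO g) (hs : SO s) : ST (g * s⁻¹) := by
  obtain ⟨a, b⟩ := hg
  obtain ⟨c, d⟩ := hs
  constructor <;> simp only [e00, e01, e10, e11, i00, i01, i10, i11, a, b, c, d] <;> ring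

theorem ST_cube {q : SL} (hq : ST q) : (q ^ 3) 0 0 = q 0 0 * (q 0 0 * q 0 0 + 9 * (q 1 0 * q 1 0)) ∧
    (q ^ 3) 1 0 = q 1 0 * (3 * (q 0 0 * q 0 0) + 3 * (q 1 0 * q 1 0)) := by
  obtain ⟨a, b⟩ := hq
  rw [pow_succ, pow_two]
  constructor <;> simp only [e00, e01, e10, e11, a, b] <;> ring

theorem ST_nine {q : SL} (hq : ST q) : q ^ 9 = 1 ∨ q ^ 9 = -1 := by
  have key : ∀ a c : ZMod 17, a * a - 3 * c * c = 1 →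
      (c * (3 * (a * a) + 3 * (c * c))) *
      (3 * ((a * (a * a + 9 * (c * c))) * (a * (a * a + 9 * (c * c)))) +
        3 * ((c * (3 * (a * a) + 3 * (c * c))) * (c * (3 * (a * a) + 3 * (c * c))))) = 0 := by
    decide
  have h3 : ST (q ^ 3) := Tt.pow_mem (mem_Tt.2 hq) 3
  have h9 : ST (q ^ 9) := Tt.pow_mem (mem_Tt.2 hq) 9
  have hc : (q ^ 9) 1 0 = 0 := by
    have e : q ^ 9 = (q ^ 3) ^ 3 := by rw [← pow_mul]
    rw [e, (ST_cube h3).2, (ST_cube hq).1, (ST_cube hq).2]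
    apply key
    have := dt q
    rw [hq.1, hq.2] at this
    exact this
  apply sq_one
  have hd := dt (q ^ 9)
  obtain ⟨a, b⟩ := h9
  rw [hc, mul_zero] at b
  rw [a, b, hc] at hd
  apply sext <;> simp only [e00, e01, e10, e11, o00, o01, o10, o11, a, b, hc]
  · linear_combination hd
  · ring
  · ring
  · linear_combination hd

theorem ST_three {q : SL} (hq : ST q) (h : q ^ 3 = 1) : q = 1 ∨ q = kk ∨ q = kk * kk := by
  have key : ∀ a c : ZMod 17, a * a - 3 * c * c = 1 → a * (a * a + 9 * (c * c)) = 1 →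
      (a = 1 ∧ c = 0) ∨ (a = 8 ∧ c = 2) ∨ (a = 8 ∧ c = 15) := by decide
  have h1 := (ST_cube hq).1
  rw [h, o00] at h1
  have h2 := dt q
  obtain ⟨a, b⟩ := hq
  rw [a, b] at h2
  rcases key _ _ h2 h1.symm with ⟨e, f⟩ | ⟨e, f⟩ | ⟨e, f⟩
  · left
    apply sext <;> simp [a, b, e, f]
  · right; left
    apply sext <;> simp only [a, b, e, f] <;> decide
  · right; right
    apply sext <;> simp only [a, b, e, f] <;> decide

/-- Element of order nine. -/
def rho : SL := mk 7 5 13 7 (by decide)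

theorem rho_ST : ST rho := by constructor <;> decide

theorem card_rho : Nat.card (Subgroup.zpowers rho) = 9 := by
  rw [Nat.card_zpowers]
  have : orderOf rho = 3 ^ 2 := by
    apply orderOf_eq_prime_pow
    · decide +kernel
    · decide +kernel
  rw [this]
  norm_num

theorem syl3 : ∃ S : Sylow 3 SL, (S : Subgroup SL) = Subgroup.zpowers rho :=
  ⟨Sylow.ofCard (Subgroup.zpowers rho) (by rw [card_rho, card_SL, fz3]; norm_num), rfl⟩

theorem rho_le : Subgroup.zpowers rho ≤ Tt := by
  rw [Subgroup.zpowers_le]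
  exact rho_ST

/-- The subgroup of order three. -/
def K3 : Subgroup SL := Subgroup.zpowers kk

theorem kk_mem : kk ∈ K3 := Subgroup.mem_zpowers kk

theorem K3_pow {x : SL} (hx : x ∈ K3) : x ^ 3 = 1 := by
  obtain ⟨n, rfl⟩ := hx
  have h3 : kk ^ 3 = 1 := by decide +kernel
  change (kk ^ n) ^ 3 = 1
  rw [← zpow_natCast, zpow_comm, zpow_natCast, h3, one_zpow]

theorem K3_ST {x : SL} (hx : x ∈ K3) : ST x := by
  have : K3 ≤ Tt := by
    rw [K3, Subgroup.zpowers_le]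
    constructor <;> decide
  exact this hx

theorem K3_mem {x : SL} (hx : x ∈ K3) : x = 1 ∨ x = kk ∨ x = kk * kk :=
  ST_three (K3_ST hx) (K3_pow hx)

theorem mem_K3 {x : SL} (hx : ST x) (h : x ^ 3 = 1) : x ∈ K3 := by
  rcases ST_three hx h with h | h | h
  · rw [h]; exact K3.one_mem
  · rw [h]; exact kk_mem
  · rw [h]; exact K3.mul_mem kk_mem kk_mem

theorem K3_le : K3 ≤ Subgroup.zpowers rho := by
  rw [K3, Subgroup.zpowers_le]
  have : kk = rho ^ 3 ∨ kk = rho ^ 6 := by decide +kernel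
  rcases this with h | h
  · rw [h]; exact Subgroup.npow_mem_zpowers _ _
  · rw [h]; exact Subgroup.npow_mem_zpowers _ _

theorem pow_of_conj {x y : SL} {n : ℕ} (h : (y * x * y⁻¹) ^ n = 1) : x ^ n = 1 := by
  rw [conj_pow] at h
  have h2 : y * x ^ n = y := by
    calc y * x ^ n = (y * x ^ n * y⁻¹) * y := by group
      _ = y := by rw [h, one_mul]
  simpa using h2

theorem K3_weak (y : SL) (h : K3.conjugate y ≤ Subgroup.zpowers rho) : K3.conjugate y = K3 := by
  apply Subgroup.eq_of_le_of_card_ge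
  · intro x hx
    apply mem_K3 (rho_le (h hx))
    rw [mem_conj] at hx
    exact pow_of_conj (K3_pow hx)
  · rw [card_conj]

theorem K3_norm {g : SL} (h : K3.conjugate g = K3) : MN g := by
  have h1 : kk ∈ K3.conjugate g := by rw [h]; exact kk_mem
  rw [mem_conj] at h1
  rcases K3_mem h1 with h2 | h2 | h2
  · have h3 : g * kk = g * 1 := by rw [mul_inv_eq_iff_eq_mul] at h2; simpa using h2
    exact absurd (mul_left_cancel h3) (by decide)
  · rw [mul_inv_eq_iff_eq_mul] at h2
    left
    have f0 := congrArg (fun x : SL => x 0 0) h2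
    have f1 := congrArg (fun x : SL => x 1 0) h2
    simp only [e00, e10, kk, mk00, mk01, mk10, mk11] at f0 f1
    exact ⟨by linear_combination 9 * f1 + (g 0 0 - g 1 1) * seventeen,
      by linear_combination 9 * f0 + (3 * g 1 0 - g 0 1) * seventeen⟩
  · rw [mul_inv_eq_iff_eq_mul] at h2
    right
    have hk2 : kk * kk = mk 8 11 15 8 (by decide) := by decide
    rw [hk2] at h2
    have f0 := congrArg (fun x : SL => x 0 0) h2
    have f1 := congrArg (fun x : SL => x 1 0) h2
    simp only [e00, e10, kk, mk00, mk01, mk10, mk11] at f0 f1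
    exact ⟨by linear_combination 9 * f1 + (8 * g 0 0 - g 1 1) * seventeen,
      by linear_combination 9 * f0 + (6 * g 1 0 - g 0 1) * seventeen⟩

theorem case3N {H : Subgroup SL} (h1 : (-1 : SL) ∈ H) (hN : ∀ x ∈ H, MN x) {g : SL} (hg : MN g) :
    ∃ x ∈ H ⊔ H.conjugate g, H.conjugate x = H.conjugate g := by
  by_cases hT : ∀ x ∈ H, ST x
  · refine ⟨1, Subgroup.one_mem _, ?_⟩
    rw [conj_one]
    symm
    apply conj_eq
    intro x hx
    rcases hg with hg | hg
    · rw [ST_comm hg (hT x hx), mul_inv_cancel_right]; exact hx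
    · rw [SO_ST hg (hT x hx), mul_inv_cancel_right]; exact H.inv_mem hx
  · push Not at hT
    obtain ⟨s, hs, hsT⟩ := hT
    have hsO : SO s := (hN s hs).resolve_left hsT
    set J := H ⊔ H.conjugate g with hJ
    have hsJ : s ∈ J := (le_sup_left : H ≤ J) hs
    have hcJ : g⁻¹ * s * g ∈ J := (le_sup_right : H.conjugate g ≤ J) (by
      rw [mem_conj]; simpa [mul_assoc] using hs)
    have h1J : (-1 : SL) ∈ J := (le_sup_left : H ≤ J) h1
    have root : ∀ q, ST q → q⁻¹ * q⁻¹ ∈ J → q ∈ J := by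
      intro q hq hm
      have h8 := J.pow_mem hm 4
      have e : (q⁻¹ * q⁻¹) ^ 4 * q ^ 9 = q := by group
      rcases ST_nine hq with h | h
      · rw [h, mul_one] at e
        rwa [e] at h8
      · rw [h] at e
        rw [← e]
        exact J.mul_mem h8 h1J
    refine ⟨g, ?_, rfl⟩
    rcases hg with hg | hg
    · apply root g hg
      have : g⁻¹ * g⁻¹ = (g⁻¹ * s * g) * s⁻¹ := by
        rw [mul_assoc g⁻¹ s g, SO_ST hsO hg]
        group
      rw [this]
      exact J.mul_mem hcJ (J.inv_mem hsJ)
    · have hq := SO_SO hg hsO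
      have hqJ : g * s⁻¹ ∈ J := by
        apply root _ hq
        have : (g * s⁻¹)⁻¹ * (g * s⁻¹)⁻¹ = s * (g⁻¹ * s * g) * s⁻¹ * s⁻¹ := by
          have h2 := SO_ST hsO hq
          have h3 : (g * s⁻¹)⁻¹ = s * (g * s⁻¹) * s⁻¹ := by
            rw [h2, mul_inv_cancel_right]
          nth_rw 2 [h3]
          group
        rw [this]
        exact J.mul_mem (J.mul_mem (J.mul_mem hsJ hcJ) (J.inv_mem hsJ)) (J.inv_mem hsJ)
      have := J.mul_mem hqJ hsJ
      simpa using this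

theorem sandwich {X Y : Subgroup SL} {i : ℕ} (hX : ∀ y ∈ aL (vs i), IJ X y)
    (hX2 : ∀ g ∈ X, In (oL i) g) (hY : ∀ y ∈ aL (vs i), IJ Y y)
    (hY2 : ∀ g ∈ Y, In (oL i) g) (hc : Nat.card X = Nat.card Y) : X = Y := by
  by_cases h : ∀ g ∈ X, In (aL (vs i)) g
  · apply Subgroup.eq_of_le_of_card_ge
    · intro g hg
      obtain ⟨x, hx, hr⟩ := h g hg
      exact (hY x hx).mem hr
    · exact hc.ge
  · push Not at h
    obtain ⟨g, hg, hgA⟩ := h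
    obtain ⟨x, hx, hr⟩ := hX2 g hg
    rw [oL, List.mem_append] at hx
    rcases hx with hx | hx
    · exact absurd ⟨x, hx, hr⟩ hgA
    have hm : ∀ x ∈ mL (vs i) (ms i), IJ X x := by
      rw [mL, List.mem_map] at hx
      obtain ⟨a, ha, rfl⟩ := hx
      obtain ⟨u, hu, hua⟩ := hX a ha
      have hmm : ∃ w : SL, R w (ms i) := by
        unfold ms
        split
        · exact ⟨mk 2 7 9 15 (by decide), rfl, rfl, rfl, rfl⟩
        · exact ⟨mk 2 7 9 15 (by decide), rfl, rfl, rfl, rfl⟩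
        · exact ⟨mk 3 9 14 14 (by decide), rfl, rfl, rfl, rfl⟩
        · exact ⟨mk 3 8 3 14 (by decide), rfl, rfl, rfl, rfl⟩
        · exact ⟨mk 3 9 14 14 (by decide), rfl, rfl, rfl, rfl⟩
        · exact ⟨mk 3 8 3 14 (by decide), rfl, rfl, rfl, rfl⟩
      obtain ⟨w, hw⟩ := hmm
      have e := hr.ext (hua.mul hw)
      rw [e] at hg
      have hwX : w ∈ X := (X.mul_mem_cancel_left hu).1 hg
      intro z hz
      rw [mL, List.mem_map] at hz
      obtain ⟨b, hb, rfl⟩ := hz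
      exact (hX b hb).mul ⟨w, hwX, hw⟩
    symm
    apply Subgroup.eq_of_le_of_card_ge
    · intro z hz
      obtain ⟨c, hc, hzc⟩ := hY2 z hz
      rw [oL, List.mem_append] at hc
      rcases hc with hc | hc
      · exact (hX c hc).mem hzc
      · exact (hm c hc).mem hzc
    · exact hc.le

theorem case3k {H : Subgroup SL} (h1 : (-1 : SL) ∈ H) (hk : kk ∈ H) : IsPronormal H := by
  have hK : K3 ≤ H := by
    rw [K3, Subgroup.zpowers_le]; exact hk
  obtain ⟨S, hSS⟩ := syl3
  apply pronormal_reduce hK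
  · intro J g
    refine weak_closed S K3 ?_ ?_ J g
    · rw [hSS]; exact K3_le
    · rw [hSS]; exact K3_weak
  intro g hg
  have hgN := K3_norm hg
  by_cases hN : ∀ x ∈ H, MN x
  · exact case3N h1 hN hgN
  by_cases hJ : H ⊔ H.conjugate g = ⊤
  · exact ⟨g, by rw [hJ]; trivial, rfl⟩
  have hkc : kk ∈ H.conjugate g := by
    apply conj_mono hK g
    rw [hg]; exact kk_mem
  have h1c : (-1 : SL) ∈ H.conjugate g := neg_one_mem_conj h1 g
  have hle1 : H ≤ H ⊔ H.conjugate g := le_sup_left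
  have hle2 : H.conjugate g ≤ H ⊔ H.conjugate g := le_sup_right
  have up1 : ∀ {X : Subgroup SL}, X ≤ H ⊔ H.conjugate g → ∀ {y}, IJ X y →
      IJ (H ⊔ H.conjugate g) y := by
    rintro X hX y ⟨z, hz, hr⟩
    exact ⟨z, hX hz, hr⟩
  rcases lemC hk h1 with h | h | ⟨i, hi, ha, hb⟩
  · exact absurd (top_le_iff.1 (h ▸ hle1)) hJ
  · exact absurd h hN
  rcases lemC hkc h1c with h | h | ⟨l, hl, hc, hd⟩
  · exact absurd (top_le_iff.1 (h ▸ hle2)) hJ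
  · exfalso
    apply hN
    intro x hx
    have h2 : g⁻¹ * x * g ∈ H.conjugate g := by
      rw [mem_conj]; simpa [mul_assoc] using hx
    have h3 : g⁻¹ * x * g ∈ Nn := h _ h2
    have h4 : g ∈ Nn := hgN
    have h5 := Nn.mul_mem (Nn.mul_mem h4 h3) (Nn.inv_mem h4)
    have h6 : g * (g⁻¹ * x * g) * g⁻¹ = x := by group
    rw [h6] at h5
    exact h5
  have hil := idx_eq (hle1 hk) (hle1 h1) hJ hi hl (fun y hy => up1 hle1 (ha y hy))
    (fun y hy => up1 hle2 (hc y hy))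
  subst hil
  refine ⟨1, Subgroup.one_mem _, ?_⟩
  rw [conj_one]
  exact sandwich ha hb hc hd (card_conj H g).symm

theorem case3 (H : Subgroup SL) (h1 : (-1 : SL) ∈ H) (h3 : 3 ∣ Nat.card H) : IsPronormal H := by
  obtain ⟨x, hx⟩ := exists_prime_orderOf_dvd_card' 3 h3
  have hx3 : (x : SL) ^ 3 = 1 := by
    have := pow_orderOf_eq_one x
    rw [hx] at this
    simpa using congrArg Subtype.val this
  have hx1 : (x : SL) ≠ 1 := by
    intro h
    rw [← Subgroup.orderOf_coe, h] at hx
    simp at hx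
  obtain ⟨S, hSS⟩ := syl3
  obtain ⟨y, hy⟩ := exists_conj_sylow S (Subgroup.zpowers (x : SL)) (by
    apply IsPGroup.of_card (n := 1)
    rw [Nat.card_zpowers, Subgroup.orderOf_coe, hx]
    norm_num)
  rw [hSS] at hy
  have hz : y⁻¹ * x * y ∈ (Subgroup.zpowers (x : SL)).conjugate y := by
    rw [mem_conj]
    simp [mul_assoc]
  have hzT := rho_le (hy hz)
  have e : y * (y⁻¹ * x * y) * y⁻¹ = x := by group
  have hz3 : (y⁻¹ * (x : SL) * y) ^ 3 = 1 := by
    apply pow_of_conj (y := y)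
    rw [e]; exact hx3
  have hzH : y⁻¹ * x * y ∈ H.conjugate y := by
    rw [mem_conj, e]; exact x.2
  rw [← pronormal_conj H y]
  apply case3k (neg_one_mem_conj h1 y)
  rcases ST_three hzT hz3 with h | h | h
  · rw [h] at e
    exact absurd (by simpa using e.symm) hx1
  · rwa [h] at hzH
  · rw [h] at hzH
    have := Subgroup.mul_mem _ hzH hzH
    have e2 : kk * kk * (kk * kk) = kk := by decide
    rwa [e2] at this

end P17

namespace P17

theorem pow4_conj {h y : SL} : (y⁻¹ * h * y) ^ 4 = -1 ↔ h ^ 4 = -1 := by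
  have := conj_pow (i := 4) (a := y⁻¹) (b := h)
  rw [inv_inv] at this
  rw [this]
  constructor
  · intro h2
    have h3 : y⁻¹ * h ^ 4 = -1 * y⁻¹ := by
      rw [← h2]; group
    have h4 : y⁻¹ * h ^ 4 = y⁻¹ * (-1) := by rw [h3]; simp
    exact mul_left_cancel h4
  · intro h2
    rw [h2]; simp

theorem twoGroup {H : Subgroup SL} (hS : H ≤ S2) (h1 : (-1 : SL) ∈ H) (hd : Nat.card H ∣ 32) :
    ¬ IsPronormal H ↔ (Nat.card H = 4 ∨ (Nat.card H = 8 ∧ ∀ h ∈ H, h ^ 4 ≠ -1)) := by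
  by_cases hex : ∃ h ∈ H, h ^ 4 = -1
  · obtain ⟨h, hh, h4⟩ := hex
    have hp := case2 H hS h hh h4
    constructor
    · intro hn; exact absurd hp hn
    · rintro (hc | ⟨-, hc⟩)
      · exact case4 hS h1 hc
      · exact absurd h4 (hc h hh)
  · push Not at hex
    by_cases hc : 4 < Nat.card H
    · have h8 := (no8 hS h1 hex hc).2.2
      have hcard : Nat.card H = 8 := by
        obtain ⟨m, hm⟩ := hd
        interval_cases h : Nat.card H <;> omega
      exact ⟨fun _ => Or.inr ⟨hcard, hex⟩, fun _ => caseV hS h1 hex hc⟩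
    · by_cases hc4 : Nat.card H = 4
      · exact ⟨fun _ => Or.inl hc4, fun _ => case4 hS h1 hc4⟩
      · have hpos : 0 < Nat.card H := Nat.card_pos
        have h2 : Nat.card H ≤ 2 := by
          obtain ⟨m, hm⟩ := hd
          interval_cases h : Nat.card H <;> omega
        constructor
        · intro hn
          exfalso
          apply hn
          have hall : ∀ x ∈ H, x = 1 ∨ x = -1 := by
            intro x hx
            by_contra hcon
            push Not at hcon
            have hne : (1 : SL) ≠ -1 := by decide
            have hsub : (({1, -1, x} : Finset SL) : Set SL) ⊆ (H : Set SL) := by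
              intro z hz
              simp only [Finset.coe_insert, Finset.coe_singleton, Set.mem_insert_iff,
                Set.mem_singleton_iff] at hz
              rcases hz with rfl | rfl | rfl
              · exact H.one_mem
              · exact h1
              · exact hx
            have h3 := Set.ncard_le_ncard hsub (Set.toFinite _)
            rw [Set.ncard_coe_finset, Finset.card_eq_three.2
              ⟨1, -1, x, hne, hcon.1.symm, hcon.2.symm, rfl⟩] at h3
            have h4 : (H : Set SL).ncard = Nat.card H := rfl
            omega
          intro g
          refine ⟨1, Subgroup.one_mem _, ?_⟩
          rw [conj_one]
          symm
          apply conj_eq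
          intro x hx
          rcases hall x hx with rfl | rfl
          · simp
          · simpa using h1
        · rintro (h | ⟨h, -⟩) <;> omega

theorem mainSL {H : Subgroup SL} (h1 : (-1 : SL) ∈ H) :
    ¬ IsPronormal H ↔ (Nat.card H = 4 ∨ (Nat.card H = 8 ∧ ∀ h ∈ H, h ^ 4 ≠ -1)) := by
  by_cases h17 : 17 ∣ Nat.card H
  · have := case17 H h17
    constructor
    · intro hn; exact absurd this hn
    · rintro (h | ⟨h, -⟩) <;> omega
  by_cases h3 : 3 ∣ Nat.card H
  · have := case3 H h1 h3
    constructor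
    · intro hn; exact absurd this hn
    · rintro (h | ⟨h, -⟩) <;> omega
  have hd : Nat.card H ∣ 32 := by
    have h0 : Nat.card H ∣ 4896 := by
      rw [← card_SL]; exact Subgroup.card_subgroup_dvd_card H
    have c17 : Nat.Coprime (Nat.card H) 17 :=
      ((Nat.Prime.coprime_iff_not_dvd (by norm_num)).2 h17).symm
    have c3 : Nat.Coprime (Nat.card H) (3 ^ 2) :=
      (((Nat.Prime.coprime_iff_not_dvd (by norm_num)).2 h3).symm).pow_right 2
    rw [show 4896 = 32 * 3 ^ 2 * 17 by norm_num] at h0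
    exact c3.dvd_of_dvd_mul_right (c17.dvd_of_dvd_mul_right h0)
  obtain ⟨S, hSS⟩ := syl2
  obtain ⟨y, hy⟩ := exists_conj_sylow S H (by
    obtain ⟨n, -, hn⟩ := (Nat.dvd_prime_pow (by norm_num : Nat.Prime 2) (m := 5)).1 (by simpa using hd)
    exact IsPGroup.of_card hn)
  rw [hSS] at hy
  have := twoGroup hy (neg_one_mem_conj h1 y) (by rw [card_conj]; exact hd)
  rw [pronormal_conj, card_conj] at this
  rw [this]
  have e : (∀ h ∈ H.conjugate y, h ^ 4 ≠ -1) ↔ (∀ h ∈ H, h ^ 4 ≠ -1) := by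
    constructor
    · intro h x hx h4
      exact h (y⁻¹ * x * y) (by rw [mem_conj]; simpa [mul_assoc] using hx) (pow4_conj.2 h4)
    · intro h x hx h4
      rw [mem_conj] at hx
      apply h _ hx
      have := (pow4_conj (h := x) (y := y⁻¹)).2 h4
      rwa [inv_inv] at this
  rw [e]

section transfer
variable {F : Type*} [Field F]

/-- The projection. -/
def proj (e : ZMod 17 ≃+* F) : SL →* Matrix.ProjectiveSpecialLinearGroup (Fin 2) F :=
  (QuotientGroup.mk' (Subgroup.center (Matrix.SpecialLinearGroup (Fin 2) F))).comp
    (Matrix.SpecialLinearGroup.map (e : ZMod 17 →+* F))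

theorem proj_surj (e : ZMod 17 ≃+* F) : Function.Surjective (proj e) := by
  intro x
  obtain ⟨A, rfl⟩ := QuotientGroup.mk'_surjective _ x
  refine ⟨Matrix.SpecialLinearGroup.map (e.symm : F →+* ZMod 17) A, ?_⟩
  rw [proj, MonoidHom.comp_apply]
  congr 1
  ext i j
  simp

theorem proj_one (e : ZMod 17 ≃+* F) (g : SL) : proj e g = 1 ↔ g = 1 ∨ g = -1 := by
  rw [proj, MonoidHom.comp_apply, QuotientGroup.mk'_apply, QuotientGroup.eq_one_iff,
    Matrix.SpecialLinearGroup.mem_center_iff]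
  constructor
  · rintro ⟨r, hr, h⟩
    have h00 := congrFun (congrFun h 0) 0
    have h01 := congrFun (congrFun h 0) 1
    have h10 := congrFun (congrFun h 1) 0
    have h11 := congrFun (congrFun h 1) 1
    simp at h00 h01 h10 h11
    have f01 : g 0 1 = 0 := e.injective (by rw [map_zero]; exact h01.symm)
    have f10 : g 1 0 = 0 := e.injective (by rw [map_zero]; exact h10.symm)
    have f11 : g 1 1 = g 0 0 := e.injective (h11.symm.trans h00)
    have hd := dt g
    rw [f01, f11] at hd
    apply sq_one
    apply sext <;> simp only [e00, e01, e10, e11, o00, o01, o10, o11, f01, f10, f11]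
    · linear_combination hd
    · ring
    · ring
    · linear_combination hd
  · rintro (rfl | rfl)
    · exact ⟨1, by simp, by simp⟩
    · refine ⟨-1, by simp, ?_⟩
      ext i j
      fin_cases i <;> fin_cases j <;> simp

theorem card_ker (e : ZMod 17 ≃+* F) : Nat.card (proj e).ker = 2 := by
  have hs : ((proj e).ker : Set SL) = (({1, -1} : Finset SL) : Set SL) := by
    ext x
    simp [MonoidHom.mem_ker, proj_one]
  have h4 : ((proj e).ker : Set SL).ncard = Nat.card (proj e).ker := rfl
  rw [← h4, hs, Set.ncard_coe_finset]
  exact Finset.card_pair (by decide)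

theorem card_lift (e : ZMod 17 ≃+* F) (H : Subgroup (Matrix.ProjectiveSpecialLinearGroup (Fin 2) F)) :
    Nat.card (H.comap (proj e)) = 2 * Nat.card H := by
  have h1 := Subgroup.card_mul_index (H.comap (proj e))
  have h2 := Subgroup.card_mul_index H
  have h3 := Subgroup.card_mul_index (proj e).ker
  rw [Subgroup.index_comap_of_surjective _ (proj_surj e)] at h1
  rw [Subgroup.index_ker, MonoidHom.range_eq_top.2 (proj_surj e), card_ker, Subgroup.card_top,
    card_SL] at h3
  rw [card_SL] at h1
  have hi : 0 < H.index := by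
    rcases Nat.eq_zero_or_pos H.index with h | h
    · rw [h] at h1; simp at h1
    · exact h
  apply Nat.eq_of_mul_eq_mul_right hi
  rw [h1, mul_assoc, h2, h3]

theorem cyclic_iff (e : ZMod 17 ≃+* F) (H : Subgroup (Matrix.ProjectiveSpecialLinearGroup (Fin 2) F))
    (hc : Nat.card H = 4) : (∀ h ∈ H.comap (proj e), h ^ 4 ≠ -1) ↔ ¬ IsCyclic H := by
  rw [← not_iff_not]
  push Not
  constructor
  · rintro ⟨h, hh, h4⟩
    rw [Subgroup.mem_comap] at hh
    have hf : Finite H := Nat.finite_of_card_ne_zero (by rw [hc]; norm_num)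
    apply isCyclic_of_orderOf_eq_card (⟨proj e h, hh⟩ : H)
    rw [hc, ← Subgroup.orderOf_coe]
    change orderOf (proj e h) = 2 ^ 2
    apply orderOf_eq_prime_pow
    · rw [← map_pow, proj_one, pow_one]
      rintro (h2 | h2)
      · have : h ^ 4 = 1 := by rw [show 4 = 2 * 2 by norm_num, pow_mul, h2, one_pow]
        rw [this] at h4
        exact absurd h4 (by decide)
      · have : h ^ 4 = 1 := by rw [show 4 = 2 * 2 by norm_num, pow_mul, h2]; simp
        rw [this] at h4
        exact absurd h4 (by decide)
    · rw [← map_pow, proj_one]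
      exact Or.inr h4
  · intro hcy
    obtain ⟨x, hx⟩ := IsCyclic.exists_ofOrder_eq_natCard (α := H)
    rw [hc] at hx
    obtain ⟨h, hh⟩ := proj_surj e x
    refine ⟨h, by rw [Subgroup.mem_comap, hh]; exact x.2, ?_⟩
    rw [← Subgroup.orderOf_coe, ← hh] at hx
    have h4 : proj e (h ^ 4) = 1 := by
      rw [map_pow, ← hx, pow_orderOf_eq_one]
    have h2 : proj e (h ^ 2) ≠ 1 := by
      rw [map_pow]
      intro h5
      have := orderOf_dvd_of_pow_eq_one h5
      rw [hx] at this
      omega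
    rcases (proj_one e _).1 h4 with h5 | h5
    · exfalso
      apply h2
      rw [proj_one]
      apply sq_one
      rw [← pow_add]
      exact h5
    · exact h5

end transfer

end P17

theorem stmt4 (F : Type*) [Field F] [Fintype F] (hF : Fintype.card F = 17)
    (H : Subgroup (Matrix.ProjectiveSpecialLinearGroup (Fin 2) F)) :
    ¬ IsPronormal H ↔ (Nat.card H = 2 ∨ (Nat.card H = 4 ∧ ¬ IsCyclic H)) := by
  have e : ZMod 17 ≃+* F := ZMod.ringEquivOfPrime F (by norm_num) hF
  have h1 : (-1 : P17.SL) ∈ H.comap (P17.proj e) := by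
    rw [Subgroup.mem_comap, (P17.proj_one e _).2 (Or.inr rfl)]
    exact H.one_mem
  have h := P17.mainSL h1
  rw [P17.pronormal_comap _ (P17.proj_surj e), P17.card_lift] at h
  rw [h]
  constructor
  · rintro (h | ⟨h, hx⟩)
    · left; omega
    · have hc : Nat.card H = 4 := by omega
      exact Or.inr ⟨hc, (P17.cyclic_iff e H hc).1 hx⟩
  · rintro (h | ⟨h, hx⟩)
    · left; omega
    · exact Or.inr ⟨by omega, (P17.cyclic_iff e H h).2 hx⟩
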